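/- arXiv:2512.22595 — 5 statements merged into one kernel-verified Lean document; each statement's English description precedes it below -/
import Mathlib

section
/- Let R → S be a flat ring homomorphism of commutative noetherian rings and M a finitely generated R-module. If M is totally self-dual over R and M ⊗_R S is nonzero, then M ⊗_R S is totally self-dual as an S-module. -/
open CategoryTheory IsLocalRing

noncomputable def ExtMod (R : Type) [CommRing R] (M N : Type) [AddCommGroup M] [Module R M]
    [AddCommGroup N] [Module R N] (i : ℕ) : ModuleCat R :=
  ((Ext R (ModuleCat.{0} R) i).obj (Opposite.op (ModuleCat.of R M))).obj (ModuleCat.of R N)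

noncomputable def mgrade (R : Type) [CommRing R] (M : Type) [AddCommGroup M] [Module R M] : ℕ :=
  sInf {i | Nontrivial (ExtMod R M R i)}

def IsTotallySelfDual (R : Type) [CommRing R] (M : Type) [AddCommGroup M] [Module R M] : Prop :=
  Nontrivial M ∧ Nonempty (ExtMod R M R (mgrade R M) ≃ₗ[R] M) ∧
    ∀ i, i ≠ mgrade R M → Subsingleton (ExtMod R M R i)

open CategoryTheory Limits TensorProduct

universe u

section BaseChange

variable (R S : Type u) [CommRing R] [CommRing S] [Algebra R S]

/-- Base change of modules along `R → S`, as a functor. -/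
noncomputable def baseChangeFunctor : ModuleCat.{u} R ⥤ ModuleCat.{u} S where
  obj M := ModuleCat.of S (S ⊗[R] M)
  map f := ModuleCat.ofHom (f.hom.baseChange S)
  map_id M := by ext : 1; exact LinearMap.baseChange_id
  map_comp f g := by ext : 1; exact LinearMap.baseChange_comp f.hom g.hom

instance : (baseChangeFunctor R S).Additive where
  map_add {M N f g} := by ext : 1; exact LinearMap.baseChange_add f.hom g.hom

lemma baseChangeFunctor_map_exact [Module.Flat R S] (T : ShortComplex (ModuleCat.{u} R))
    (hT : T.Exact) : (T.map (baseChangeFunctor R S)).Exact := by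
  rw [ShortComplex.ShortExact.moduleCat_exact_iff_function_exact] at hT ⊢
  exact Module.Flat.lTensor_exact S hT

instance [Module.Flat R S] : PreservesFiniteLimits (baseChangeFunctor R S) :=
  (((baseChangeFunctor R S).exact_tfae.out 1 3 rfl rfl).mp (baseChangeFunctor_map_exact R S)).1

instance [Module.Flat R S] : PreservesFiniteColimits (baseChangeFunctor R S) :=
  (((baseChangeFunctor R S).exact_tfae.out 1 3 rfl rfl).mp (baseChangeFunctor_map_exact R S)).2

instance (M : ModuleCat.{u} R) [Projective M] : Projective ((baseChangeFunctor R S).obj M) := by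
  have : Module.Projective R M := (IsProjective.iff_projective M).mpr ‹_›
  exact (IsProjective.iff_projective _).mp
    (inferInstanceAs (Module.Projective S (S ⊗[R] M)))

variable {R}

lemma baseChangeFunctor_hom_ext {M : ModuleCat.{u} R} {N : ModuleCat.{u} S}
    {f g : (baseChangeFunctor R S).obj M ⟶ N}
    (h : ∀ (s : S) (m : M), f.hom (s ⊗ₜ[R] m : S ⊗[R] M) = g.hom (s ⊗ₜ[R] m : S ⊗[R] M)) :
    f = g := by
  refine ModuleCat.hom_ext (LinearMap.ext fun (z : S ⊗[R] M) ↦ ?_)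
  let φ : S ⊗[R] M →+ N := f.hom.toAddMonoidHom
  let ψ : S ⊗[R] M →+ N := g.hom.toAddMonoidHom
  change φ z = ψ z
  induction z with
  | zero => rw [map_zero, map_zero]
  | add x y hx hy => rw [map_add, map_add, hx, hy]
  | tmul s m => exact h s m

/-- A flat base change of a projective resolution is a projective resolution. -/
noncomputable def CategoryTheory.ProjectiveResolution.baseChange [Module.Flat R S]
    {M : ModuleCat.{u} R} (P : ProjectiveResolution M) :
    ProjectiveResolution ((baseChangeFunctor R S).obj M) where
  complex := ((baseChangeFunctor R S).mapHomologicalComplex _).obj P.complex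
  projective n := inferInstanceAs (Projective ((baseChangeFunctor R S).obj (P.complex.X n)))
  π := ((baseChangeFunctor R S).mapHomologicalComplex _).map P.π ≫
    (HomologicalComplex.singleMapHomologicalComplex (baseChangeFunctor R S) _ 0).hom.app M
  quasiIso := by infer_instance

/-- Taking the dual of a finite module commutes with flat base change. -/
noncomputable def dualBaseChangeIso [IsNoetherianRing R] [Module.Flat R S] (X : ModuleCat.{u} R)
    [Module.Finite R X] :
    (baseChangeFunctor R S).obj (ModuleCat.of R (X ⟶ ModuleCat.of R R)) ≅
      ModuleCat.of S ((baseChangeFunctor R S).obj X ⟶ ModuleCat.of S S) :=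
  have : Module.FinitePresentation R X := Module.finitePresentation_of_finite R X
  LinearEquiv.toModuleIso
    ((ModuleCat.homLinearEquiv (S := R) (M := X) (N := ModuleCat.of R R)).baseChange R S _ _ ≪≫ₗ
    (Module.FinitePresentation.isBaseChange_map R X R S).equiv ≪≫ₗ
    (TensorProduct.AlgebraTensorModule.rid R S S).congrRight ≪≫ₗ
    (ModuleCat.homLinearEquiv (S := S) (M := ModuleCat.of S (S ⊗[R] X))
      (N := ModuleCat.of S S)).symm)

lemma dualBaseChangeIso_hom_tmul [IsNoetherianRing R] [Module.Flat R S] (X : ModuleCat.{u} R)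
    [Module.Finite R X] (s : S) (f : X ⟶ ModuleCat.of R R) :
    (dualBaseChangeIso S X).hom.hom (s ⊗ₜ[R] f : S ⊗[R] (X ⟶ ModuleCat.of R R)) =
      s • ModuleCat.ofHom ((TensorProduct.AlgebraTensorModule.rid R S S).toLinearMap ∘ₗ
        f.hom.baseChange S) := by
  have : Module.FinitePresentation R X := Module.finitePresentation_of_finite R X
  change ModuleCat.ofHom ((TensorProduct.AlgebraTensorModule.rid R S S).congrRight
    ((Module.FinitePresentation.isBaseChange_map R X R S).equiv (s ⊗ₜ[R] f.hom))) = _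
  rw [IsBaseChange.equiv_tmul, map_smul]
  rfl

end BaseChange

section Resolution

variable {R : Type u} [CommRing R]

lemma exists_projectiveResolution_of_exact (M : ModuleCat.{u} R) (X : ℕ → ModuleCat.{u} R)
    [∀ n, Projective (X n)] (d : ∀ n, X (n + 1) ⟶ X n) (ε : X 0 ⟶ M)
    (hd : ∀ n, Function.Exact (d (n + 1)) (d n)) (hdε : Function.Exact (d 0) ε)
    (hε : Function.Surjective ε) :
    ∃ P : ProjectiveResolution M, P.complex.X = X := by
  have sq (n : ℕ) : d (n + 1) ≫ d n = 0 := by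
    ext x
    exact (hd n).apply_apply_eq_zero x
  have of_d (n : ℕ) : (ChainComplex.of X d sq).d (n + 1) n = d n := ChainComplex.of_d X d n
  have sqε : (ChainComplex.of X d sq).d 1 0 ≫ ε = 0 := by
    rw [of_d 0]
    ext x
    exact hdε.apply_apply_eq_zero x
  refine ⟨{
    complex := ChainComplex.of X d sq
    projective := fun n ↦ inferInstanceAs (Projective (X n))
    π := (ChainComplex.toSingle₀Equiv _ _).symm ⟨ε, sqε⟩
    quasiIso := ⟨fun n ↦ ?_⟩ }, rfl⟩
  cases n with
  | zero =>
    rw [ChainComplex.quasiIsoAt₀_iff, ShortComplex.quasiIso_iff_of_zeros']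
    · have hT : (ShortComplex.mk _ _ sqε).Exact ∧ Epi ε := by
        refine ⟨?_, (ModuleCat.epi_iff_surjective ε).mpr hε⟩
        rw [ShortComplex.ShortExact.moduleCat_exact_iff_function_exact]
        change Function.Exact ((ChainComplex.of X d sq).d 1 0) ε
        rw [of_d 0]
        exact hdε
      refine (ShortComplex.exact_and_epi_g_iff_of_iso ?_).2 hT
      exact ShortComplex.isoMk (Iso.refl _) (Iso.refl _) (Iso.refl _)
        ((Category.id_comp _).trans (Category.comp_id _).symm)
        ((Category.id_comp _).trans (Category.comp_id _).symm)
    all_goals rfl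
  | succ n =>
    rw [quasiIsoAt_iff_exactAt']
    · rw [HomologicalComplex.exactAt_iff' _ (n + 2) (n + 1) n (by simp) (by simp),
        ShortComplex.ShortExact.moduleCat_exact_iff_function_exact]
      change Function.Exact ((ChainComplex.of X d sq).d (n + 2) (n + 1))
        ((ChainComplex.of X d sq).d (n + 1) n)
      rw [of_d (n + 1), of_d n]
      exact hd n
    · apply ChainComplex.exactAt_succ_single_obj

/-- The successive syzygies of a finite module over a noetherian ring. -/
noncomputable def syzygy [IsNoetherianRing R] (M : ModuleCat.{u} R) [Module.Finite R M] :
    ℕ → {K : ModuleCat.{u} R // Module.Finite R K}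
  | 0 => ⟨M, ‹_›⟩
  | n + 1 =>
    have := (syzygy M n).2
    ⟨ModuleCat.of R (LinearMap.ker (Module.Finite.exists_fin' R (syzygy M n).1).choose_spec.choose),
      inferInstance⟩

lemma exists_finite_projectiveResolution [IsNoetherianRing R] (M : ModuleCat.{u} R)
    [Module.Finite R M] :
    ∃ P : ProjectiveResolution M, ∀ n, Module.Finite R (P.complex.X n) := by
  have hfin (n : ℕ) : Module.Finite R (syzygy M n).1 := (syzygy M n).2
  let r (n : ℕ) : ℕ := (Module.Finite.exists_fin' R (syzygy M n).1).choose
  let p (n : ℕ) : (Fin (r n) → R) →ₗ[R] (syzygy M n).1 :=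
    (Module.Finite.exists_fin' R (syzygy M n).1).choose_spec.choose
  have hp (n : ℕ) : Function.Surjective (p n) :=
    (Module.Finite.exists_fin' R (syzygy M n).1).choose_spec.choose_spec
  let ι (n : ℕ) : (syzygy M (n + 1)).1 →ₗ[R] (Fin (r n) → R) := (LinearMap.ker (p n)).subtype
  have hι (n : ℕ) : Function.Injective (ι n) := Subtype.val_injective
  have hιp (n : ℕ) : Function.Exact (ι n) (p n) := LinearMap.exact_subtype_ker_map (p n)
  have hdp (n : ℕ) : Function.Exact (ι n ∘ₗ p (n + 1)) (p n) :=
    (hp (n + 1)).comp_exact_iff_exact.mpr (hιp n)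
  have (n : ℕ) : Projective (ModuleCat.of R (Fin (r n) → R)) :=
    (IsProjective.iff_projective _).mp inferInstance
  obtain ⟨P, hP⟩ := exists_projectiveResolution_of_exact M
    (fun n ↦ ModuleCat.of R (Fin (r n) → R)) (fun n ↦ ModuleCat.ofHom (ι n ∘ₗ p (n + 1)))
    (ModuleCat.ofHom (p 0)) (fun n ↦ (hι n).comp_exact_iff_exact.mpr (hdp (n + 1))) (hdp 0) (hp 0)
  exact ⟨P, fun n ↦ hP ▸ inferInstanceAs (Module.Finite R (Fin (r n) → R))⟩

end Resolution

section Ext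

variable {R : Type u} [CommRing R] [IsNoetherianRing R] (S : Type u) [CommRing S] [Algebra R S]
  [Module.Flat R S]

lemma dualBaseChangeIso_hom_naturality {X Y : ModuleCat.{u} R}
    [Module.Finite R X] [Module.Finite R Y] (g : X ⟶ Y) :
    (baseChangeFunctor R S).map (((linearYoneda R _).obj (ModuleCat.of R R)).map g.op) ≫
        (dualBaseChangeIso S X).hom =
      (dualBaseChangeIso S Y).hom ≫
        ((linearYoneda S _).obj (ModuleCat.of S S)).map ((baseChangeFunctor R S).map g).op := by
  refine baseChangeFunctor_hom_ext S fun s (f : Y ⟶ ModuleCat.of R R) ↦ ?_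
  change (dualBaseChangeIso S X).hom.hom (s ⊗ₜ[R] (g ≫ f)) =
    (baseChangeFunctor R S).map g ≫ (dualBaseChangeIso S Y).hom.hom (s ⊗ₜ[R] f)
  rw [dualBaseChangeIso_hom_tmul, dualBaseChangeIso_hom_tmul]
  refine Eq.trans (congrArg (s • ·) (ModuleCat.hom_ext ?_)) (Linear.comp_smul ..).symm
  exact congrArg ((TensorProduct.AlgebraTensorModule.rid R S S).toLinearMap ∘ₗ ·)
    (LinearMap.baseChange_comp g.hom f.hom)

/-- If all terms of `P` are finite, base change commutes with the homology of the dual of `P`. -/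
noncomputable def dualHomologyBaseChangeIso {M : ModuleCat.{u} R} (P : ProjectiveResolution M)
    [∀ n, Module.Finite R (P.complex.X n)] (n : ℕ) :
    (baseChangeFunctor R S).obj ((P.complex.linearYonedaObj R (ModuleCat.of R R)).homology n) ≅
      ((P.baseChange S).complex.linearYonedaObj S (ModuleCat.of S S)).homology n :=
  (((P.complex.linearYonedaObj R (ModuleCat.of R R)).sc n).mapHomologyIso
      (baseChangeFunctor R S)).symm ≪≫
    ShortComplex.homologyMapIso (ShortComplex.isoMk
      (dualBaseChangeIso S _) (dualBaseChangeIso S _) (dualBaseChangeIso S _)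
      (dualBaseChangeIso_hom_naturality S _).symm (dualBaseChangeIso_hom_naturality S _).symm)

end Ext

lemma nonempty_extMod_baseChange (R S M : Type) [CommRing R] [IsNoetherianRing R] [CommRing S]
    [Algebra R S] [Module.Flat R S] [AddCommGroup M] [Module R M] [Module.Finite R M] (i : ℕ) :
    Nonempty (ExtMod S (S ⊗[R] M) S i ≃ₗ[S] S ⊗[R] ExtMod R M R i) := by
  obtain ⟨P, hP⟩ := exists_finite_projectiveResolution (ModuleCat.of R M)
  exact ⟨(((P.baseChange S).isoExt i (ModuleCat.of S S)) ≪≫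
    (dualHomologyBaseChangeIso S P i).symm ≪≫
    (baseChangeFunctor R S).mapIso (P.isoExt i (ModuleCat.of R R)).symm).toLinearEquiv⟩

lemma mgrade_eq_of_forall_ne_subsingleton {R M : Type} [CommRing R] [AddCommGroup M] [Module R M]
    {n : ℕ} (hn : Nontrivial (ExtMod R M R n))
    (h : ∀ i, i ≠ n → Subsingleton (ExtMod R M R i)) : mgrade R M = n := by
  have : {i | Nontrivial (ExtMod R M R i)} = {n} := by
    ext i
    refine ⟨fun hi ↦ ?_, fun hi ↦ hi ▸ hn⟩
    by_contra hin
    exact not_nontrivial_iff_subsingleton.mpr (h i hin) hi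
  rw [mgrade, this, csInf_singleton]

/-- Flat base change of a totally self-dual module is totally self-dual if nonzero. -/
theorem stmt_1 (R S : Type) [CommRing R] [IsNoetherianRing R] [CommRing S] [IsNoetherianRing S]
    [Algebra R S] [Module.Flat R S]
    (M : Type) [AddCommGroup M] [Module R M] [Module.Finite R M]
    (hM : IsTotallySelfDual R M) (hne : Nontrivial (TensorProduct R S M)) :
    IsTotallySelfDual S (TensorProduct R S M) := by
  obtain ⟨-, ⟨e⟩, hvan⟩ := hM
  obtain ⟨e₀⟩ := nonempty_extMod_baseChange R S M (mgrade R M)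
  have e' : ExtMod S (S ⊗[R] M) S (mgrade R M) ≃ₗ[S] S ⊗[R] M :=
    e₀ ≪≫ₗ e.baseChange R S _ _
  have hvan' (i : ℕ) (hi : i ≠ mgrade R M) : Subsingleton (ExtMod S (S ⊗[R] M) S i) := by
    obtain ⟨e₁⟩ := nonempty_extMod_baseChange R S M i
    have := hvan i hi
    exact e₁.toEquiv.subsingleton
  have hgrade := mgrade_eq_of_forall_ne_subsingleton e'.toEquiv.nontrivial hvan'
  refine ⟨hne, ?_, ?_⟩ <;> rw [hgrade]
  exacts [⟨e'⟩, hvan']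
end

section
/- Let R be a commutative noetherian ring, M a finitely generated R-module, and x ∈ Ann_R(M) an R-regular element. Then M is totally self-dual as an R-module if and only if M is totally self-dual as an R/(x)-module. -/
open CategoryTheory IsLocalRing

theorem exists_addEquiv_of_surjective {A E E' : Type*} [AddCommGroup A] [AddCommGroup E]
    [AddCommGroup E'] (f : A →+ E) (g : A →+ E') (hf : Function.Surjective f)
    (hg : Function.Surjective g) (h : ∀ a, f a = 0 ↔ g a = 0) :
    ∃ e : E ≃+ E', ∀ a, e (f a) = g a := by
  have hker : f.ker = g.ker := by
    ext a
    simpa [AddMonoidHom.mem_ker] using h a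
  refine ⟨(QuotientAddGroup.quotientKerEquivOfSurjective f hf).symm.trans
    ((QuotientAddGroup.quotientAddEquivOfEq hker).trans
      (QuotientAddGroup.quotientKerEquivOfSurjective g hg)), fun a ↦ ?_⟩
  have : (QuotientAddGroup.quotientKerEquivOfSurjective f hf).symm (f a) = (a : A ⧸ f.ker) := by
    rw [AddEquiv.symm_apply_eq]
    rfl
  simp only [AddEquiv.trans_apply, this]
  rfl

section DimensionShifting

variable {R : Type} [CommRing R]

/-- Composition with a fixed extension class `ξ`, as a linear map on morphisms. -/
noncomputable def precompClass {Y Y' : ModuleCat.{0} R} {c : ℕ} (ξ : Abelian.Ext Y' Y c)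
    (A : ModuleCat.{0} R) : (A ⟶ Y') →ₗ[R] Abelian.Ext A Y c where
  toFun φ := (Abelian.Ext.mk₀ φ).comp ξ (zero_add c)
  map_add' := by simp [Abelian.Ext.mk₀_add]
  map_smul' := by simp [Abelian.Ext.mk₀_smul]

theorem exists_equiv_ext_succ {T : ShortComplex (ModuleCat.{0} R)} (hT : T.ShortExact)
    (Y : ModuleCat.{0} R) (j : ℕ) [Subsingleton (Abelian.Ext T.X₂ Y j)]
    [Subsingleton (Abelian.Ext T.X₂ Y (j + 1))] :
    Nonempty (Abelian.Ext T.X₁ Y j ≃ₗ[R] Abelian.Ext T.X₃ Y (j + 1)) := by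
  refine ⟨LinearEquiv.ofBijective
    (Abelian.Ext.precompOfLinear hT.extClass R Y (add_comm 1 j)) ⟨?_, ?_⟩⟩
  · rw [injective_iff_map_eq_zero]
    intro v hv
    obtain ⟨w, rfl⟩ := Abelian.Ext.contravariant_sequence_exact₁ hT Y v (add_comm 1 j) hv
    simp [Subsingleton.elim w 0]
  · intro v
    exact Abelian.Ext.contravariant_sequence_exact₃ hT Y v (Subsingleton.elim _ _) (add_comm 1 j)

theorem exists_presentation_of_shortExact {T : ShortComplex (ModuleCat.{0} R)}
    (hT : T.ShortExact) {Y Y' : ModuleCat.{0} R} {c : ℕ} (ξ : Abelian.Ext Y' Y c)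
    (h₁ : Function.Bijective (precompClass ξ T.X₁))
    (h₂ : Function.Surjective (precompClass ξ T.X₂))
    [Subsingleton (Abelian.Ext T.X₂ Y (c + 1))] :
    ∃ f : (T.X₁ ⟶ Y') →ₗ[R] Abelian.Ext T.X₃ Y (c + 1), Function.Surjective f ∧
      ∀ φ, f φ = 0 ↔ ∃ ψ : T.X₂ ⟶ Y', T.f ≫ ψ = φ := by
  refine ⟨(Abelian.Ext.precompOfLinear hT.extClass R Y (add_comm 1 c)).comp
    (precompClass ξ T.X₁), ?_, fun φ ↦ ⟨fun h ↦ ?_, ?_⟩⟩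
  · intro v
    obtain ⟨u, hu⟩ := Abelian.Ext.contravariant_sequence_exact₃ hT Y v (Subsingleton.elim _ _)
      (add_comm 1 c)
    obtain ⟨φ, rfl⟩ := h₁.2 u
    exact ⟨φ, hu⟩
  · obtain ⟨w, hw⟩ := Abelian.Ext.contravariant_sequence_exact₁ hT Y _ (add_comm 1 c) h
    obtain ⟨ψ, rfl⟩ := h₂ w
    refine ⟨ψ, h₁.1 ?_⟩
    rw [← hw]
    simp [precompClass]
  · rintro ⟨ψ, rfl⟩
    have : precompClass ξ T.X₁ (T.f ≫ ψ) =
        (Abelian.Ext.mk₀ T.f).comp (precompClass ξ T.X₂ ψ) (zero_add c) := by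
      simp [precompClass]
    simp [this]

variable {X : ℕ → Type} [∀ n, AddCommGroup (X n)] [∀ n, Module R (X n)]
  {N Y' : Type} [AddCommGroup N] [Module R N] [AddCommGroup Y'] [Module R Y']

/-- Dimension shifting along a resolution `X` of `N`: if composing with `ξ` identifies the maps
from the syzygies to `Y'` with `Ext^c`, then `Ext^(c+1+n)(N, Y)` is the quotient of the maps from
the `n`-th syzygy to `Y'` by those extending to `X n`. -/
theorem exists_presentation_ext (d : ∀ n, X (n + 1) →ₗ[R] X n) (π : X 0 →ₗ[R] N)
    (hd : ∀ n, Function.Exact (d (n + 1)) (d n)) (hπ : Function.Exact (d 0) π)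
    (hπ' : Function.Surjective π) (Y : ModuleCat.{0} R) {c : ℕ}
    (ξ : Abelian.Ext (ModuleCat.of R Y') Y c)
    (hZ : ∀ n, Function.Bijective (precompClass ξ (ModuleCat.of R (LinearMap.range (d n)))))
    (hX : ∀ n, Function.Surjective (precompClass ξ (ModuleCat.of R (X n))))
    (hX' : ∀ n i, Subsingleton (Abelian.Ext (ModuleCat.of R (X n)) Y (c + 1 + i))) (n : ℕ) :
    ∃ f : (LinearMap.range (d n) →ₗ[R] Y') →ₗ[R] Abelian.Ext (ModuleCat.of R N) Y (c + 1 + n),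
      Function.Surjective f ∧ ∀ φ, f φ = 0 ↔
        ∃ ψ : X n →ₗ[R] Y', ψ.comp (LinearMap.range (d n)).subtype = φ := by
  let T₀ : ShortComplex (ModuleCat.{0} R) :=
    ShortComplex.moduleCatMk (LinearMap.range (d 0)).subtype π (by
      ext ⟨_, y, rfl⟩
      exact hπ.apply_apply_eq_zero y)
  have hT₀ : T₀.ShortExact := by
    have h : Function.Exact (LinearMap.range (d 0)).subtype π := fun y ↦ by
      simpa using hπ y
    exact ModuleCat.shortComplex_shortExact T₀ h Subtype.val_injective hπ'
  let T (k : ℕ) : ShortComplex (ModuleCat.{0} R) :=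
    ShortComplex.moduleCatMk (LinearMap.range (d (k + 1))).subtype (d k).rangeRestrict (by
      ext ⟨_, y, rfl⟩
      exact (hd k).apply_apply_eq_zero y)
  have hT (k : ℕ) : (T k).ShortExact := by
    have h : Function.Exact (LinearMap.range (d (k + 1))).subtype (d k).rangeRestrict := fun y ↦ by
      simpa [Subtype.ext_iff] using hd k y
    exact ModuleCat.shortComplex_shortExact (T k) h Subtype.val_injective
      (LinearMap.surjective_rangeRestrict (d k))
  have shift (m : ℕ) : ∀ k, Nonempty
      (Abelian.Ext (ModuleCat.of R (LinearMap.range (d (k + m)))) Y (c + 1) ≃ₗ[R]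
        Abelian.Ext (ModuleCat.of R (LinearMap.range (d k))) Y (c + 1 + m)) := by
    induction m with
    | zero => exact fun k ↦ ⟨LinearEquiv.refl _ _⟩
    | succ m ih =>
      intro k
      have : Subsingleton (Abelian.Ext (T k).X₂ Y (c + 1 + m)) := hX' _ _
      have : Subsingleton (Abelian.Ext (T k).X₂ Y (c + 1 + m + 1)) := hX' _ (m + 1)
      obtain ⟨e⟩ := exists_equiv_ext_succ (hT k) Y (c + 1 + m)
      obtain ⟨e'⟩ := ih (k + 1)
      rw [show k + (m + 1) = k + 1 + m by lia]
      exact ⟨e'.trans e⟩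
  have conclude {T : ShortComplex (ModuleCat.{0} R)} {E : Type} [AddCommGroup E] [Module R E]
      (hT : T.ShortExact) (h₁ : Function.Bijective (precompClass ξ T.X₁))
      (h₂ : Function.Surjective (precompClass ξ T.X₂))
      (h₃ : Subsingleton (Abelian.Ext T.X₂ Y (c + 1)))
      (e : Abelian.Ext T.X₃ Y (c + 1) ≃ₗ[R] E) :
      ∃ f : (T.X₁ →ₗ[R] Y') →ₗ[R] E, Function.Surjective f ∧
        ∀ φ, f φ = 0 ↔ ∃ ψ : T.X₂ →ₗ[R] Y', ψ.comp T.f.hom = φ := by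
    obtain ⟨f, hf, hf'⟩ := exists_presentation_of_shortExact hT ξ h₁ h₂
    refine ⟨e.toLinearMap ∘ₗ f ∘ₗ (ModuleCat.homLinearEquiv (S := R)
      (M := T.X₁) (N := ModuleCat.of R Y')).symm.toLinearMap, ?_, fun φ ↦ ?_⟩
    · simpa using hf
    · simp only [LinearMap.comp_apply, LinearEquiv.coe_coe, map_eq_zero_iff _ e.injective, hf']
      exact ⟨fun ⟨ψ, h⟩ ↦ ⟨ψ.hom, congrArg ModuleCat.Hom.hom h⟩,
        fun ⟨ψ, h⟩ ↦ ⟨ModuleCat.ofHom ψ, ModuleCat.hom_ext h⟩⟩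
  cases n with
  | zero => exact conclude hT₀ (hZ 0) (hX 0) (hX' 0 0) (LinearEquiv.refl _ _)
  | succ m =>
    have : Subsingleton (Abelian.Ext T₀.X₂ Y (c + 1 + m)) := hX' _ _
    have : Subsingleton (Abelian.Ext T₀.X₂ Y (c + 1 + m + 1)) := hX' _ (m + 1)
    obtain ⟨e⟩ := exists_equiv_ext_succ hT₀ Y (c + 1 + m)
    obtain ⟨e'⟩ := shift m 0
    rw [zero_add] at e'
    exact conclude (hT m) (hZ _) (hX _) (hX' _ 0) (e'.trans e)

end DimensionShifting

section ProjectiveResolution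

variable {R : Type} [CommRing R] {N : ModuleCat.{0} R} (P : ProjectiveResolution N)

theorem CategoryTheory.ProjectiveResolution.exact_d (n : ℕ) :
    Function.Exact (P.complex.d (n + 2) (n + 1)).hom (P.complex.d (n + 1) n).hom :=
  (ShortComplex.ShortExact.moduleCat_exact_iff_function_exact _).mp (P.exact_succ n)

theorem CategoryTheory.ProjectiveResolution.surjective_π : Function.Surjective (P.π.f 0).hom :=
  (ModuleCat.epi_iff_surjective (P.π.f 0)).mp inferInstance

theorem CategoryTheory.ProjectiveResolution.exact_d_π :
    Function.Exact (P.complex.d 1 0).hom (P.π.f 0).hom :=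
  (ShortComplex.ShortExact.moduleCat_exact_iff_function_exact
    (ShortComplex.mk _ _ P.complex_d_comp_π_f_zero)).mp
    (ShortComplex.exact_of_g_is_cokernel _ P.isColimitCokernelCofork)

theorem CategoryTheory.ShortComplex.exists_presentation_homology
    (T : ShortComplex (ModuleCat.{0} R)) :
    ∃ f : LinearMap.ker T.g.hom →ₗ[R] T.homology, Function.Surjective f ∧
      ∀ z, f z = 0 ↔ ∃ y, T.f.hom y = z := by
  let e := T.moduleCatHomologyIso.toLinearEquiv.symm
  refine ⟨e.toLinearMap ∘ₗ (LinearMap.range T.moduleCatToCycles).mkQ, ?_, fun z ↦ ?_⟩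
  · exact e.surjective.comp (Submodule.mkQ_surjective _)
  · refine (map_eq_zero_iff e e.injective).trans ?_
    refine (Submodule.Quotient.mk_eq_zero _).trans ?_
    simp only [LinearMap.mem_range, Subtype.ext_iff]
    rfl

theorem exists_comp_eq_of_ker_le {A B C : Type} [AddCommGroup A] [Module R A] [AddCommGroup B]
    [Module R B] [AddCommGroup C] [Module R C] {p : A →ₗ[R] B} (hp : Function.Surjective p)
    {z : A →ₗ[R] C} (h : LinearMap.ker p ≤ LinearMap.ker z) : ∃ φ : B →ₗ[R] C, φ ∘ₗ p = z := by
  refine ⟨(LinearMap.ker p).liftQ z h ∘ₗ (p.quotKerEquivOfSurjective hp).symm.toLinearMap, ?_⟩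
  ext v
  have : (p.quotKerEquivOfSurjective hp).symm (p v) = (LinearMap.ker p).mkQ v := by
    rw [LinearEquiv.symm_apply_eq]
    rfl
  simp [this]

/-- The derived functor `Ext^(n+1)(N, Y)` is the quotient of the maps from the `n`-th syzygy to `Y`
by those extending to `P.complex.X n`. -/
theorem CategoryTheory.ProjectiveResolution.exists_presentation_ext (Y : ModuleCat.{0} R) (n : ℕ) :
    ∃ f : (LinearMap.range (P.complex.d (n + 1) n).hom →ₗ[R] Y) →ₗ[R]
      (((Ext R (ModuleCat.{0} R) (n + 1)).obj (Opposite.op N)).obj Y),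
      Function.Surjective f ∧ ∀ φ, f φ = 0 ↔
        ∃ ψ : P.complex.X n →ₗ[R] Y,
          ψ.comp (LinearMap.range (P.complex.d (n + 1) n).hom).subtype = φ := by
  let K := P.complex.linearYonedaObj R Y
  let e : ((((Ext R (ModuleCat.{0} R) (n + 1)).obj (Opposite.op N)).obj Y) : ModuleCat R) ≃ₗ[R]
      (K.sc' n (n + 1) (n + 2)).homology :=
    (P.isoExt (n + 1) Y ≪≫ ShortComplex.homologyMapIso
      (K.isoSc' n (n + 1) (n + 2) (by simp) (by simp))).toLinearEquiv
  obtain ⟨f, hf, hf'⟩ := ShortComplex.exists_presentation_homology (K.sc' n (n + 1) (n + 2))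
  let d := (P.complex.d (n + 1) n).hom
  let lift : (LinearMap.range d →ₗ[R] Y) →ₗ[R] LinearMap.ker (K.sc' n (n + 1) (n + 2)).g.hom :=
    { toFun φ := ⟨ModuleCat.ofHom (φ ∘ₗ d.rangeRestrict), by
        suffices h : P.complex.d (n + 2) (n + 1) ≫ ModuleCat.ofHom (φ ∘ₗ d.rangeRestrict) = 0 from h
        ext v
        have : d.rangeRestrict ((P.complex.d (n + 2) (n + 1)).hom v) = 0 :=
          Subtype.ext ((P.exact_d n).apply_apply_eq_zero v)
        exact (congrArg φ this).trans (map_zero φ)⟩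
      map_add' := fun _ _ ↦ rfl
      map_smul' := fun _ _ ↦ rfl }
  have lift_surj : Function.Surjective lift := by
    rintro ⟨z, hz⟩
    let z' : P.complex.X (n + 1) ⟶ Y := z
    have hz' : P.complex.d (n + 2) (n + 1) ≫ z' = 0 := hz
    have hle : LinearMap.ker d.rangeRestrict ≤ LinearMap.ker z'.hom := by
      intro v hv
      rw [LinearMap.ker_rangeRestrict, LinearMap.mem_ker] at hv
      obtain ⟨w, rfl⟩ := (P.exact_d n v).mp hv
      exact congr($hz' w)
    obtain ⟨φ, hφ⟩ := exists_comp_eq_of_ker_le d.surjective_rangeRestrict hle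
    exact ⟨φ, Subtype.ext (ModuleCat.hom_ext hφ)⟩
  refine ⟨e.symm.toLinearMap ∘ₗ f ∘ₗ lift, ?_, fun φ ↦ ?_⟩
  · exact e.symm.surjective.comp (hf.comp lift_surj)
  · refine (map_eq_zero_iff e.symm e.symm.injective).trans ((hf' _).trans ?_)
    constructor
    · rintro ⟨y, hy⟩
      let y' : P.complex.X n ⟶ Y := y
      have hy' : P.complex.d (n + 1) n ≫ y' = ModuleCat.ofHom (φ ∘ₗ d.rangeRestrict) := hy
      refine ⟨y'.hom, ?_⟩
      ext ⟨_, v, rfl⟩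
      exact congr($hy' v)
    · rintro ⟨ψ, rfl⟩
      exact ⟨ModuleCat.ofHom ψ, rfl⟩

theorem CategoryTheory.ProjectiveResolution.nonempty_ext_zero_equiv {N : ModuleCat.{0} R}
    (P : ProjectiveResolution N) (Y : ModuleCat.{0} R) :
    Nonempty ((((Ext R (ModuleCat.{0} R) 0).obj (Opposite.op N)).obj Y) ≃ₗ[R] (N →ₗ[R] Y)) := by
  let K := P.complex.linearYonedaObj R Y
  let e : ((((Ext R (ModuleCat.{0} R) 0).obj (Opposite.op N)).obj Y) : ModuleCat R) ≃ₗ[R]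
      (K.sc' 0 0 1).homology :=
    (P.isoExt 0 Y ≪≫ ShortComplex.homologyMapIso
      (K.isoSc' 0 0 1 (by simp) (by simp))).toLinearEquiv
  obtain ⟨f, hf, hf'⟩ := ShortComplex.exists_presentation_homology (K.sc' 0 0 1)
  let π : P.complex.X 0 →ₗ[R] N := (P.π.f 0).hom
  let lift : (N →ₗ[R] Y) →ₗ[R] LinearMap.ker (K.sc' 0 0 1).g.hom :=
    { toFun φ := ⟨ModuleCat.ofHom (φ ∘ₗ π), by
        suffices h : P.complex.d 1 0 ≫ ModuleCat.ofHom (φ ∘ₗ π) = 0 from h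
        ext v
        exact (congrArg φ (P.exact_d_π.apply_apply_eq_zero v)).trans (map_zero φ)⟩
      map_add' := fun _ _ ↦ rfl
      map_smul' := fun _ _ ↦ rfl }
  have lift_surj : Function.Surjective lift := by
    rintro ⟨z, hz⟩
    let z' : P.complex.X 0 ⟶ Y := z
    have hz' : P.complex.d 1 0 ≫ z' = 0 := hz
    have hle : LinearMap.ker π ≤ LinearMap.ker z'.hom := by
      intro v hv
      obtain ⟨w, rfl⟩ := (P.exact_d_π v).mp hv
      exact congr($hz' w)
    obtain ⟨φ, hφ⟩ := exists_comp_eq_of_ker_le P.surjective_π hle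
    exact ⟨φ, Subtype.ext (ModuleCat.hom_ext hφ)⟩
  refine ⟨LinearEquiv.symm (.ofBijective (e.symm.toLinearMap ∘ₗ f ∘ₗ lift) ⟨?_, ?_⟩)⟩
  · rw [injective_iff_map_eq_zero]
    intro φ hφ
    obtain ⟨y, hy⟩ := (hf' _).mp ((map_eq_zero_iff e.symm e.symm.injective).mp hφ)
    have hd : P.complex.d 0 0 = 0 := P.complex.shape 0 0 (by simp)
    let y' : P.complex.X 0 ⟶ Y := y
    have hy' : P.complex.d 0 0 ≫ y' = ModuleCat.ofHom (φ ∘ₗ π) := hy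
    rw [hd, Limits.zero_comp] at hy'
    ext v
    obtain ⟨w, rfl⟩ := P.surjective_π v
    exact congr($hy'.symm w)
  · exact e.symm.surjective.comp (hf.comp lift_surj)

end ProjectiveResolution

section Comparison

variable {R : Type} [CommRing R]

theorem bijective_precompClass_mk₀_id (Y A : ModuleCat.{0} R) :
    Function.Bijective (precompClass (Abelian.Ext.mk₀ (𝟙 Y)) A) := by
  have : ⇑(precompClass (Abelian.Ext.mk₀ (𝟙 Y)) A) = Abelian.Ext.mk₀ := by
    ext φ
    simp [precompClass]
  rw [this]
  exact Abelian.Ext.mk₀_bijective A Y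

/-- In positive degrees, the derived functor `Ext` agrees with `Abelian.Ext`. -/
theorem nonempty_ext_succ_equiv_abelianExt (N Y : ModuleCat.{0} R) (n : ℕ) :
    Nonempty ((((Ext R (ModuleCat.{0} R) (n + 1)).obj (Opposite.op N)).obj Y) ≃ₗ[R]
      Abelian.Ext N Y (n + 1)) := by
  let P := projectiveResolution N
  obtain ⟨f, hf, hf'⟩ := P.exists_presentation_ext Y n
  obtain ⟨g, hg, hg'⟩ := exists_presentation_ext (X := fun n ↦ P.complex.X n)
    (fun n ↦ (P.complex.d (n + 1) n).hom) (P.π.f 0).hom P.exact_d P.exact_d_π P.surjective_π Y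
    (Abelian.Ext.mk₀ (𝟙 Y)) (fun n ↦ bijective_precompClass_mk₀_id Y _)
    (fun n ↦ (bijective_precompClass_mk₀_id Y _).2)
    (fun n i ↦ by
      rw [show 0 + 1 + i = i + 1 by lia]
      exact Abelian.Ext.subsingleton_of_projective (P.complex.X n) Y i) n
  obtain ⟨e, he⟩ := exists_addEquiv_of_surjective f.toAddMonoidHom g.toAddMonoidHom hf hg
    (fun φ ↦ (hf' φ).trans (hg' φ).symm)
  have key : Nonempty ((((Ext R (ModuleCat.{0} R) (n + 1)).obj (Opposite.op N)).obj Y) ≃ₗ[R]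
      Abelian.Ext N Y (0 + 1 + n)) := by
    refine ⟨e.toLinearEquiv fun r v ↦ ?_⟩
    obtain ⟨φ, rfl⟩ := hf v
    rw [← map_smul]
    refine (he (r • φ)).trans ?_
    refine (map_smul g r φ).trans ?_
    exact congrArg (r • ·) (he φ).symm
  have transport (m : ℕ) (hm : m = n + 1) (h : Nonempty ((((Ext R (ModuleCat.{0} R) (n + 1)).obj
      (Opposite.op N)).obj Y) ≃ₗ[R] Abelian.Ext N Y m)) : Nonempty ((((Ext R (ModuleCat.{0} R)
      (n + 1)).obj (Opposite.op N)).obj Y) ≃ₗ[R] Abelian.Ext N Y (n + 1)) := hm ▸ h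
  exact transport _ (by lia) key

end Comparison

section Rees

variable {R : Type} [CommRing R] {x : R}

variable (x) in
/-- The sequence `R → R → R ⧸ (x)` whose first map is multiplication by `x`. -/
noncomputable def mulQuotientShortComplex : ShortComplex (ModuleCat.{0} R) :=
  ShortComplex.mk (x • 𝟙 (ModuleCat.of R R))
    (ModuleCat.ofHom (Ideal.span {x}).mkQ) (by
      ext
      refine (map_smul (Ideal.span {x}).mkQ x (1 : R)).symm.trans ?_
      simp)

theorem shortExact_mulQuotientShortComplex (hx : x ∈ nonZeroDivisors R) :
    (mulQuotientShortComplex x).ShortExact := by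
  refine ModuleCat.shortComplex_shortExact _ (fun (y : R) ↦ ?_) (fun (y : R) (z : R) h ↦ ?_)
    (Submodule.mkQ_surjective _)
  · refine Ideal.Quotient.eq_zero_iff_mem.trans (Ideal.mem_span_singleton'.trans ?_)
    exact exists_congr fun a ↦ by rw [mul_comm]; rfl
  · exact (mul_cancel_left_mem_nonZeroDivisors hx).mp h

theorem subsingleton_linearMap_of_smul_eq_zero (hx : x ∈ nonZeroDivisors R) (A : Type)
    [AddCommGroup A] [Module R A] (hA : ∀ a : A, x • a = 0) : Subsingleton (A →ₗ[R] R) := by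
  refine subsingleton_of_forall_eq 0 fun φ ↦ LinearMap.ext fun a ↦ ?_
  refine (mul_left_mem_nonZeroDivisors_eq_zero_iff hx).mp ?_
  rw [← smul_eq_mul, ← map_smul, hA, map_zero]

theorem bijective_precompClass_extClass (hx : x ∈ nonZeroDivisors R) (A : Type)
    [AddCommGroup A] [Module R A] (hA : ∀ a : A, x • a = 0) :
    Function.Bijective (precompClass (shortExact_mulQuotientShortComplex hx).extClass
      (ModuleCat.of R A)) := by
  have hid : x • 𝟙 (ModuleCat.of R A) = 0 := by
    ext a
    exact hA a
  constructor
  · rw [injective_iff_map_eq_zero]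
    intro φ hφ
    obtain ⟨w, hw⟩ := Abelian.Ext.covariant_sequence_exact₃ _
      (shortExact_mulQuotientShortComplex hx) _ (zero_add 1) hφ
    obtain ⟨ψ, rfl⟩ := (Abelian.Ext.mk₀_bijective _ _).2 w
    have := subsingleton_linearMap_of_smul_eq_zero hx A hA
    have hψ : ψ = 0 := ModuleCat.hom_ext (Subsingleton.elim (α := A →ₗ[R] R) _ _)
    rw [← (Abelian.Ext.mk₀_bijective _ _).1.eq_iff, ← hw, hψ]
    simp
  · intro v
    have h (u : Abelian.Ext (ModuleCat.of R A) (ModuleCat.of R R) 1) :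
        u.comp (Abelian.Ext.mk₀ (x • 𝟙 (ModuleCat.of R R))) (add_zero 1) = 0 := by
      have : u.comp (Abelian.Ext.mk₀ (x • 𝟙 (ModuleCat.of R R))) (add_zero 1) =
          (Abelian.Ext.mk₀ (x • 𝟙 (ModuleCat.of R A))).comp u (zero_add 1) := by
        simp [Abelian.Ext.mk₀_smul]
      rw [this, hid, Abelian.Ext.mk₀_zero, Abelian.Ext.zero_comp]
    obtain ⟨w, hw⟩ := Abelian.Ext.covariant_sequence_exact₁ _
      (shortExact_mulQuotientShortComplex hx) v (h v) (zero_add 1)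
    obtain ⟨φ, rfl⟩ := (Abelian.Ext.mk₀_bijective _ _).2 w
    exact ⟨φ, hw⟩

theorem subsingleton_ext_of_projective_quotient (hx : x ∈ nonZeroDivisors R) (A : Type)
    [AddCommGroup A] [Module R A] [Module (R ⧸ Ideal.span {x}) A]
    [IsScalarTower R (R ⧸ Ideal.span {x}) A] [Module.Projective (R ⧸ Ideal.span {x}) A]
    (Y : ModuleCat.{0} R) (j : ℕ) : Subsingleton (Abelian.Ext (ModuleCat.of R A) Y (j + 2)) := by
  let T : ShortComplex (ModuleCat.{0} R) :=
    ShortComplex.mk (x • 𝟙 (ModuleCat.of R (A →₀ R)))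
      (ModuleCat.ofHom (Finsupp.mapRange.linearMap (Ideal.span {x}).mkQ)) (by
        ext f a
        have hmk (r : R) : (Ideal.span {x}).mkQ (x * r) = 0 :=
          Ideal.Quotient.eq_zero_iff_mem.mpr (Ideal.mul_mem_right _ _
            (Ideal.mem_span_singleton_self x))
        exact hmk _)
  have hT : T.ShortExact := by
    refine ModuleCat.shortComplex_shortExact _ (fun (y : A →₀ R) ↦ ⟨fun h ↦ ?_, ?_⟩)
      (fun (y : A →₀ R) (z : A →₀ R) h ↦ Finsupp.ext fun a ↦ ?_)
      (Finsupp.mapRange_surjective _ (map_zero _) (Submodule.mkQ_surjective _))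
    · have hy (a : A) : ∃ c, x * c = y a := by
        have : (Ideal.span {x}).mkQ (y a) = 0 := DFunLike.congr_fun h a
        obtain ⟨c, hc⟩ := Ideal.mem_span_singleton.mp (Ideal.Quotient.eq_zero_iff_mem.mp this)
        exact ⟨c, hc.symm⟩
      choose c hc using hy
      refine ⟨Finsupp.onFinset y.support c fun a ha ↦ ?_, Finsupp.ext hc⟩
      rw [Finsupp.mem_support_iff, ← hc]
      exact fun h0 ↦ ha ((mul_left_mem_nonZeroDivisors_eq_zero_iff hx).mp h0)
    · rintro ⟨z, rfl⟩
      exact congr($(T.zero) z)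
    · exact (mul_cancel_left_mem_nonZeroDivisors hx).mp (DFunLike.congr_fun h a)
  have hfree (v : Abelian.Ext (ModuleCat.of R (A →₀ R ⧸ Ideal.span {x})) Y (j + 2)) : v = 0 := by
    have : Projective T.X₂ := ModuleCat.projective_of_free (M := ModuleCat.of R (A →₀ R))
      Finsupp.basisSingleOne
    have : Projective T.X₁ := this
    obtain ⟨u, hu⟩ := Abelian.Ext.contravariant_sequence_exact₃ hT Y v
      (Abelian.Ext.eq_zero_of_projective _) (show 1 + (j + 1) = j + 2 by lia)
    rw [← hu, Abelian.Ext.eq_zero_of_projective u]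
    simp
  obtain ⟨s, hs⟩ := Module.projective_def.mp ‹Module.Projective (R ⧸ Ideal.span {x}) A›
  refine subsingleton_of_forall_eq 0 fun v ↦ ?_
  let i : ModuleCat.of R A ⟶ ModuleCat.of R (A →₀ R ⧸ Ideal.span {x}) :=
    ModuleCat.ofHom (s.restrictScalars R)
  let p : ModuleCat.of R (A →₀ R ⧸ Ideal.span {x}) ⟶ ModuleCat.of R A :=
    ModuleCat.ofHom ((Finsupp.linearCombination (R ⧸ Ideal.span {x}) id).restrictScalars R)
  have hip : i ≫ p = 𝟙 _ := by
    ext a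
    exact hs a
  rw [← Abelian.Ext.mk₀_id_comp v, ← hip, ← Abelian.Ext.mk₀_comp_mk₀_assoc,
    hfree ((Abelian.Ext.mk₀ p).comp v (zero_add _))]
  simp

variable {X : ℕ → Type} [∀ n, AddCommGroup (X n)] [∀ n, Module R (X n)]
  [∀ n, Module (R ⧸ Ideal.span {x}) (X n)]
  [∀ n, IsScalarTower R (R ⧸ Ideal.span {x}) (X n)] {N : Type} [AddCommGroup N]
  [Module R N] [Module (R ⧸ Ideal.span {x}) N]
  [IsScalarTower R (R ⧸ Ideal.span {x}) N]

theorem smul_eq_zero_of_isScalarTower_quotient (a : N) : x • a = 0 := by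
  rw [← algebraMap_smul (R ⧸ Ideal.span {x}) x a, Ideal.Quotient.algebraMap_eq,
    Ideal.Quotient.eq_zero_iff_mem.mpr (Ideal.mem_span_singleton_self x), zero_smul]

theorem exists_presentation_ext_of_quotient (hx : x ∈ nonZeroDivisors R)
    (d : ∀ n, X (n + 1) →ₗ[R ⧸ Ideal.span {x}] X n) (π : X 0 →ₗ[R ⧸ Ideal.span {x}] N)
    (hd : ∀ n, Function.Exact (d (n + 1)) (d n)) (hπ : Function.Exact (d 0) π)
    (hπ' : Function.Surjective π) [∀ n, Module.Projective (R ⧸ Ideal.span {x}) (X n)] (n : ℕ) :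
    ∃ f : (LinearMap.range (d n) →ₗ[R ⧸ Ideal.span {x}] R ⧸ Ideal.span {x}) →ₗ[R]
        Abelian.Ext (ModuleCat.of R N) (ModuleCat.of R R) (n + 2),
      Function.Surjective f ∧ ∀ φ, f φ = 0 ↔
        ∃ ψ : X n →ₗ[R ⧸ Ideal.span {x}] R ⧸ Ideal.span {x},
          ψ.comp (LinearMap.range (d n)).subtype = φ := by
  obtain ⟨f, hf, hf'⟩ := exists_presentation_ext (fun n ↦ (d n).restrictScalars R)
    (π.restrictScalars R) hd hπ hπ' (ModuleCat.of R R)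
    (shortExact_mulQuotientShortComplex hx).extClass
    (fun n ↦ bijective_precompClass_extClass hx _ fun a ↦
      Subtype.ext (smul_eq_zero_of_isScalarTower_quotient _))
    (fun n ↦ (bijective_precompClass_extClass hx _ smul_eq_zero_of_isScalarTower_quotient).2)
    (fun n i ↦ by
      rw [show 1 + 1 + i = i + 2 by lia]
      exact subsingleton_ext_of_projective_quotient hx _ _ _) n
  rw [show n + 2 = 1 + 1 + n by lia]
  have hS : Function.Surjective (algebraMap R (R ⧸ Ideal.span {x})) := Ideal.Quotient.mk_surjective
  let j' : LinearMap.range ((d n).restrictScalars R) →ₗ[R] LinearMap.range (d n) :=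
    { toFun z := ⟨z.1, z.2⟩
      map_add' _ _ := rfl
      map_smul' _ _ := rfl }
  let t : (LinearMap.range (d n) →ₗ[R ⧸ Ideal.span {x}] R ⧸ Ideal.span {x}) →ₗ[R]
      (LinearMap.range ((d n).restrictScalars R) →ₗ[R] R ⧸ Ideal.span {x}) :=
    { toFun φ := (φ.restrictScalars R).comp j'
      map_add' _ _ := rfl
      map_smul' _ _ := rfl }
  refine ⟨f ∘ₗ t, hf.comp fun φ ↦ ?_, fun φ ↦ (hf' _).trans ⟨fun ⟨ψ, h⟩ ↦ ?_, fun ⟨ψ, h⟩ ↦ ?_⟩⟩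
  · let j : LinearMap.range (d n) →ₗ[R] LinearMap.range ((d n).restrictScalars R) :=
      { toFun z := ⟨z.1, z.2⟩
        map_add' _ _ := rfl
        map_smul' _ _ := rfl }
    let φ' : LinearMap.range (d n) →ₗ[R] R ⧸ Ideal.span {x} := φ.comp j
    exact ⟨φ'.extendScalarsOfSurjective hS, rfl⟩
  · refine ⟨ψ.extendScalarsOfSurjective hS, LinearMap.ext fun z ↦ ?_⟩
    exact congr($h ⟨z.1, z.2⟩)
  · exact ⟨ψ.restrictScalars R, by rw [← h]; rfl⟩

theorem exists_extMod_zero_equiv (hx : x ∈ nonZeroDivisors R) :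
    ∃ e : ExtMod R N R 1 ≃+ ExtMod (R ⧸ Ideal.span {x}) N (R ⧸ Ideal.span {x}) 0,
      ∀ (r : R) v, e (r • v) = algebraMap R (R ⧸ Ideal.span {x}) r • e v := by
  obtain ⟨e₁⟩ := nonempty_ext_succ_equiv_abelianExt (ModuleCat.of R N) (ModuleCat.of R R) 0
  let e₂ := LinearEquiv.ofBijective _
    (bijective_precompClass_extClass hx N smul_eq_zero_of_isScalarTower_quotient)
  let e₃ : (ModuleCat.of R N ⟶ ModuleCat.of R (R ⧸ Ideal.span {x})) ≃ₗ[R]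
      (N →ₗ[R] R ⧸ Ideal.span {x}) := ModuleCat.homLinearEquiv
  let e₄ : (N →ₗ[R] R ⧸ Ideal.span {x}) ≃ₗ[R]
      (N →ₗ[R ⧸ Ideal.span {x}] R ⧸ Ideal.span {x}) :=
    LinearMap.extendScalarsOfSurjectiveEquiv Ideal.Quotient.mk_surjective
  obtain ⟨e₅⟩ := ProjectiveResolution.nonempty_ext_zero_equiv
    (projectiveResolution (ModuleCat.of (R ⧸ Ideal.span {x}) N))
    (ModuleCat.of (R ⧸ Ideal.span {x}) (R ⧸ Ideal.span {x}))
  let e := ((e₁.trans e₂.symm).trans e₃).trans e₄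
  refine ⟨e.toAddEquiv.trans e₅.symm.toAddEquiv, fun r v ↦ ?_⟩
  refine (congrArg e₅.symm ((map_smul e r v).trans
    (algebraMap_smul (R ⧸ Ideal.span {x}) r (e v)).symm)).trans ?_
  exact map_smul e₅.symm _ _

theorem exists_extMod_succ_equiv (hx : x ∈ nonZeroDivisors R) (n : ℕ) :
    ∃ e : ExtMod R N R (n + 2) ≃+ ExtMod (R ⧸ Ideal.span {x}) N (R ⧸ Ideal.span {x}) (n + 1),
      ∀ (r : R) v, e (r • v) = algebraMap R (R ⧸ Ideal.span {x}) r • e v := by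
  obtain ⟨e₁⟩ := nonempty_ext_succ_equiv_abelianExt (ModuleCat.of R N) (ModuleCat.of R R) (n + 1)
  let P := projectiveResolution (ModuleCat.of (R ⧸ Ideal.span {x}) N)
  obtain ⟨g, hg, hg'⟩ := P.exists_presentation_ext
    (ModuleCat.of (R ⧸ Ideal.span {x}) (R ⧸ Ideal.span {x})) n
  let _ (n : ℕ) : Module R (P.complex.X n) :=
    Module.compHom _ (algebraMap R (R ⧸ Ideal.span {x}))
  have (n : ℕ) : IsScalarTower R (R ⧸ Ideal.span {x}) (P.complex.X n) :=
    .of_algebraMap_smul fun _ _ ↦ rfl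
  have (n : ℕ) : Module.Projective (R ⧸ Ideal.span {x}) (P.complex.X n) :=
    (IsProjective.iff_projective _).mpr (P.projective n)
  let π : P.complex.X 0 →ₗ[R ⧸ Ideal.span {x}] N := (P.π.f 0).hom
  obtain ⟨f, hf, hf'⟩ := exists_presentation_ext_of_quotient (X := fun n ↦ P.complex.X n) (N := N)
    hx (fun n ↦ (P.complex.d (n + 1) n).hom) π P.exact_d P.exact_d_π P.surjective_π n
  obtain ⟨e, he⟩ := exists_addEquiv_of_surjective f.toAddMonoidHom g.toAddMonoidHom hf hg
    (fun φ ↦ (hf' φ).trans (hg' φ).symm)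
  refine ⟨e₁.toAddEquiv.trans e, fun r v ↦ ?_⟩
  obtain ⟨φ, hφ⟩ := hf (e₁ v)
  have h₁ : e₁ (r • v) = f (r • φ) :=
    (map_smul e₁ r v).trans ((congrArg (r • ·) hφ.symm).trans (map_smul f r φ).symm)
  have h₂ : r • φ = algebraMap R (R ⧸ Ideal.span {x}) r • φ := (algebraMap_smul _ r φ).symm
  have h₃ : e (e₁ v) = g φ := (congrArg e hφ.symm).trans (he φ)
  refine (congrArg e h₁).trans ((he (r • φ)).trans ((congrArg g h₂).trans ?_))
  exact (map_smul g _ φ).trans (congrArg (algebraMap R (R ⧸ Ideal.span {x}) r • ·) h₃.symm)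

/-- Rees's lemma. -/
theorem exists_extMod_equiv (hx : x ∈ nonZeroDivisors R) (n : ℕ) :
    ∃ e : ExtMod R N R (n + 1) ≃+ ExtMod (R ⧸ Ideal.span {x}) N (R ⧸ Ideal.span {x}) n,
      ∀ (r : R) v, e (r • v) = algebraMap R (R ⧸ Ideal.span {x}) r • e v :=
  match n with
  | 0 => exists_extMod_zero_equiv hx
  | n + 1 => exists_extMod_succ_equiv hx n

end Rees

theorem isTotallySelfDual_iff_exists (T : Type) [CommRing T] (M : Type) [AddCommGroup M]
    [Module T M] : IsTotallySelfDual T M ↔ Nontrivial M ∧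
      ∃ n, Nonempty (ExtMod T M T n ≃ₗ[T] M) ∧ ∀ i, i ≠ n → Subsingleton (ExtMod T M T i) := by
  refine ⟨fun ⟨h, h'⟩ ↦ ⟨h, _, h'⟩, fun ⟨h, n, ⟨e⟩, hn⟩ ↦ ⟨h, ?_⟩⟩
  have hset : {i | Nontrivial (ExtMod T M T i)} = {n} := by
    ext i
    refine ⟨fun hi ↦ by_contra fun hne ↦ ?_, ?_⟩
    · have := hn i hne
      exact not_nontrivial _ hi
    · rintro rfl
      exact e.toEquiv.nontrivial
  have : mgrade T M = n := by rw [mgrade, hset, csInf_singleton]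
  rw [this]
  exact ⟨⟨e⟩, hn⟩

/-- For an `R`-regular element `x` annihilating `M`, `M` is totally self-dual over `R`
iff it is totally self-dual over `R ⧸ (x)`. -/
theorem stmt_2 (R : Type) [CommRing R] [IsNoetherianRing R]
    (M : Type) [AddCommGroup M] [Module R M] [Module.Finite R M]
    (x : R) (hx : x ∈ nonZeroDivisors R) (hann : ∀ m : M, x • m = 0)
    [Module (R ⧸ Ideal.span {x}) M] [IsScalarTower R (R ⧸ Ideal.span {x}) M] :
    IsTotallySelfDual R M ↔ IsTotallySelfDual (R ⧸ Ideal.span {x}) M := by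
  have h₀ : Subsingleton (ExtMod R M R 0) := by
    obtain ⟨e⟩ := (projectiveResolution (ModuleCat.of R M)).nonempty_ext_zero_equiv
      (ModuleCat.of R R)
    have := subsingleton_linearMap_of_smul_eq_zero hx M hann
    exact e.toEquiv.subsingleton
  rw [isTotallySelfDual_iff_exists, isTotallySelfDual_iff_exists]
  refine and_congr_right fun hM ↦ ⟨?_, ?_⟩
  · rintro ⟨_ | n, ⟨f⟩, hn⟩
    · exact absurd f.symm.toEquiv.subsingleton (not_subsingleton M)
    · obtain ⟨e, he⟩ := exists_extMod_equiv (N := M) hx n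
      refine ⟨n, ⟨(e.symm.trans f.toAddEquiv).toLinearEquiv fun r v ↦ ?_⟩, fun i hi ↦ ?_⟩
      · obtain ⟨r, rfl⟩ := Ideal.Quotient.mk_surjective r
        obtain ⟨w, rfl⟩ := e.surjective v
        have : e.symm (algebraMap R (R ⧸ Ideal.span {x}) r • e w) = r • w := by
          rw [← he, e.symm_apply_apply]
        refine (congrArg f this).trans ?_
        rw [map_smul, ← algebraMap_smul (R ⧸ Ideal.span {x}) r (f w)]
        simp
      · obtain ⟨e', -⟩ := exists_extMod_equiv (N := M) hx i
        have := hn (i + 1) (by lia)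
        exact e'.symm.toEquiv.subsingleton
  · rintro ⟨n, ⟨f⟩, hn⟩
    obtain ⟨e, he⟩ := exists_extMod_equiv (N := M) hx n
    refine ⟨n + 1, ⟨(e.trans f.toAddEquiv).toLinearEquiv fun r v ↦ ?_⟩, fun i hi ↦ ?_⟩
    · refine (congrArg f (he r v)).trans ((map_smul f _ _).trans ?_)
      exact algebraMap_smul _ _ _
    · cases i with
      | zero => exact h₀
      | succ i =>
        obtain ⟨e', -⟩ := exists_extMod_equiv (N := M) hx i
        have := hn i (by lia)
        exact e'.toEquiv.subsingleton
end

section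
/- Let M be a totally self-dual module of grade g over a commutative noetherian ring R, and let x ∈ R be an M-regular element with M ≠ xM. Then M/xM is a totally self-dual R-module of grade g+1. -/
open CategoryTheory IsLocalRing Pointwise

section ExtComparison

variable {R : Type*} [CommRing R] {C : Type*} [Category* C] [Abelian C] [Linear R C]

namespace CategoryTheory.ProjectiveResolution

variable [HasExt C] {X Y : C} (P : ProjectiveResolution X)

lemma smul_extMk {n : ℕ} (r : R) (f : P.complex.X n ⟶ Y) (m : ℕ) (hm : n + 1 = m)
    (hf : P.complex.d m n ≫ f = 0) :
    r • P.extMk f m hm hf = P.extMk (r • f) m hm (by simp [hf]) := by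
  rw [Abelian.Ext.smul_eq_comp_mk₀, extMk_comp_mk₀]
  simp

lemma extMk_zero_eq_zero_iff (f : P.complex.X 0 ⟶ Y) (m : ℕ) (hm : 0 + 1 = m)
    (hf : P.complex.d m 0 ≫ f = 0) :
    P.extMk f m hm hf = 0 ↔ f = 0 := by
  refine ⟨fun h ↦ ?_, fun h ↦ by subst h; simp⟩
  simp only [← P.extEquivCohomologyClass.apply_eq_iff_eq,
    extEquivCohomologyClass_extMk, extEquivCohomologyClass_zero,
    CochainComplex.HomComplex.CohomologyClass.mk_eq_zero_iff] at h
  rw [CochainComplex.HomComplex.Cocycle.toSingleMk_mem_coboundaries_iff _ _ _ _ _ 1 (by lia)] at h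
  obtain ⟨g, hg⟩ := h
  rw [(CochainComplex.isZero_of_isStrictlyLE P.cochainComplex 0 1).eq_of_src g 0,
    Limits.comp_zero] at hg
  simpa using hg.symm

lemma extMk_eq_zero_iff_exists_prev {n : ℕ} (f : P.complex.X n ⟶ Y) (m : ℕ) (hm : n + 1 = m)
    (hf : P.complex.d m n ≫ f = 0) :
    P.extMk f m hm hf = 0 ↔
      ∃ g : P.complex.X ((ComplexShape.up ℕ).prev n) ⟶ Y, P.complex.d n _ ≫ g = f := by
  cases n with
  | zero =>
    rw [extMk_zero_eq_zero_iff]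
    simp [eq_comm]
  | succ p => exact P.extMk_eq_zero_iff f m hm hf _ (by simp)

/-- The linear map sending a cocycle of `Hom(P, Y)` to its class in `Ext X Y n`. -/
noncomputable def cocyclesToExt (n : ℕ) :
    LinearMap.ker ((P.complex.linearYonedaObj R Y).sc'
      ((ComplexShape.up ℕ).prev n) n (n + 1)).g.hom →ₗ[R] Abelian.Ext X Y n where
  toFun f := P.extMk f.1 (n + 1) rfl f.2
  map_add' _ _ := (P.add_extMk _ _ _ _ _ _).symm
  map_smul' r _ := (P.smul_extMk r _ _ _ _).symm

lemma cocyclesToExt_surjective (n : ℕ) :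
    Function.Surjective (P.cocyclesToExt (R := R) (Y := Y) n) := fun α ↦ by
  obtain ⟨f, hf, rfl⟩ := P.extMk_surjective α (n + 1) rfl
  exact ⟨⟨f, hf⟩, rfl⟩

lemma ker_cocyclesToExt (n : ℕ) :
    LinearMap.ker (P.cocyclesToExt (R := R) (Y := Y) n) =
      LinearMap.range ((P.complex.linearYonedaObj R Y).sc'
        ((ComplexShape.up ℕ).prev n) n (n + 1)).moduleCatToCycles := by
  ext f
  refine (P.extMk_eq_zero_iff_exists_prev f.1 (n + 1) rfl f.2).trans ?_
  exact exists_congr fun g ↦ ⟨fun h ↦ Subtype.ext h, fun h ↦ congrArg Subtype.val h⟩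

/-- The derived functor `Ext` agrees with the `Ext` defined through the derived category. -/
noncomputable def extLinearEquiv [EnoughProjectives C] (n : ℕ) :
    ((Ext R C n).obj (Opposite.op X)).obj Y ≃ₗ[R] Abelian.Ext X Y n :=
  (P.isoExt n Y ≪≫
    ShortComplex.homologyMapIso ((P.complex.linearYonedaObj R Y).isoSc'
      ((ComplexShape.up ℕ).prev n) n (n + 1) rfl (by simp)) ≪≫
    ShortComplex.moduleCatHomologyIso _).toLinearEquiv ≪≫ₗ
  Submodule.quotEquivOfEq _ _ (P.ker_cocyclesToExt n).symm ≪≫ₗ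
  (P.cocyclesToExt n).quotKerEquivOfSurjective (P.cocyclesToExt_surjective n)

end CategoryTheory.ProjectiveResolution

end ExtComparison

/-- `ExtMod` agrees with the `Ext` defined through the derived category. -/
noncomputable def extModLinearEquiv (R : Type) [CommRing R] (M N : Type) [AddCommGroup M]
    [Module R M] [AddCommGroup N] [Module R N] (i : ℕ) :
    ExtMod R M N i ≃ₗ[R] Abelian.Ext (ModuleCat.of R M) (ModuleCat.of R N) i :=
  (projectiveResolution (ModuleCat.of R M)).extLinearEquiv i

section SelfDual

universe u

variable {R : Type u} [CommRing R] {M : ModuleCat.{u} R} {N : ModuleCat.{u} R} {x : R}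

lemma ModuleCat.mk₀_smulShortComplex_f_comp {i : ℕ} (e : Abelian.Ext M N i) :
    (Abelian.Ext.mk₀ (M.smulShortComplex x).f).comp e (zero_add i) = x • e := by
  change (Abelian.Ext.mk₀ (x • 𝟙 M)).comp e (zero_add i) = x • e
  rw [Abelian.Ext.mk₀_smul, Abelian.Ext.smul_comp, Abelian.Ext.mk₀_id_comp]

/-- If `Ext^i(M, N)` has no `x`-torsion and `Ext^j(M, N)` vanishes for `j + 1 = i`, then
`Ext^i(M/xM, N)` vanishes. -/
lemma ModuleCat.subsingleton_ext_smulShortComplex (hreg : IsSMulRegular M x) (i : ℕ)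
    (h : ∀ j, j + 1 = i → Subsingleton (Abelian.Ext M N j))
    (hx : ∀ e : Abelian.Ext M N i, x • e = 0 → e = 0) :
    Subsingleton (Abelian.Ext (M.smulShortComplex x).X₃ N i) := by
  refine subsingleton_of_forall_eq 0 fun e ↦ ?_
  have he : (Abelian.Ext.mk₀ (M.smulShortComplex x).g).comp e (zero_add i) = 0 := by
    apply hx
    refine (ModuleCat.mk₀_smulShortComplex_f_comp _).symm.trans ?_
    refine (Abelian.Ext.mk₀_comp_mk₀_assoc ..).trans ?_
    rw [(M.smulShortComplex x).zero, Abelian.Ext.mk₀_zero, Abelian.Ext.zero_comp]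
    rfl
  cases i with
  | zero =>
    exact Abelian.Ext.precomp_mk₀_injective_of_epi N (M.smulShortComplex x).g
      (he.trans (map_zero _).symm)
  | succ j =>
    obtain ⟨e', rfl⟩ := Abelian.Ext.contravariant_sequence_exact₃
      hreg.smulShortComplex_shortExact N e he (add_comm 1 j)
    have : e' = 0 := (h j rfl).elim _ _
    rw [this, Abelian.Ext.comp_zero]

/-- If `Ext^{i+1}(M, N)` vanishes, then `Ext^{i+1}(M/xM, N)` is `Ext^i(M, N)/x Ext^i(M, N)`. -/
noncomputable def ModuleCat.extSmulShortComplexEquiv (hreg : IsSMulRegular M x) (i : ℕ)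
    (h : Subsingleton (Abelian.Ext M N (i + 1))) :
    (Abelian.Ext M N i ⧸ (x • ⊤ : Submodule R (Abelian.Ext M N i))) ≃ₗ[R]
      Abelian.Ext (M.smulShortComplex x).X₃ N (i + 1) :=
  let δ : Abelian.Ext M N i →ₗ[R] Abelian.Ext (M.smulShortComplex x).X₃ N (i + 1) :=
    hreg.smulShortComplex_shortExact.extClass.precompOfLinear R N (add_comm 1 i)
  have hker : LinearMap.ker δ = x • ⊤ := by
    ext e
    rw [Submodule.mem_smul_pointwise_iff_exists]
    constructor
    · intro he
      obtain ⟨e', he'⟩ := Abelian.Ext.contravariant_sequence_exact₁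
        hreg.smulShortComplex_shortExact N e (add_comm 1 i) he
      exact ⟨e', trivial, (ModuleCat.mk₀_smulShortComplex_f_comp e').symm.trans he'⟩
    · rintro ⟨e', -, rfl⟩
      rw [← ModuleCat.mk₀_smulShortComplex_f_comp]
      exact hreg.smulShortComplex_shortExact.extClass_comp_assoc _ (h := add_comm 1 i)
  have hsurj : Function.Surjective δ := fun e ↦
    Abelian.Ext.contravariant_sequence_exact₃ hreg.smulShortComplex_shortExact N e
      (h.elim _ _) (add_comm 1 i)
  Submodule.quotEquivOfEq _ _ hker.symm ≪≫ₗ δ.quotKerEquivOfSurjective hsurj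

end SelfDual

lemma mgrade_eq_of_nontrivial {R : Type} [CommRing R] {M : Type} [AddCommGroup M] [Module R M]
    {n : ℕ} (h : Nontrivial (ExtMod R M R n))
    (h' : ∀ i, i ≠ n → Subsingleton (ExtMod R M R i)) : mgrade R M = n := by
  have : {i | Nontrivial (ExtMod R M R i)} = {n} := by
    ext i
    refine ⟨fun hi ↦ ?_, fun hi ↦ ?_⟩
    · by_contra hne
      exact not_subsingleton_iff_nontrivial.mpr hi (h' i hne)
    · rw [Set.mem_singleton_iff.mp hi]
      exact h
  rw [mgrade, this, csInf_singleton]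

/-- If `M` is totally self-dual of grade `g` and `x` is `M`-regular with `M ≠ xM`,
then `M/xM` is totally self-dual of grade `g + 1`. -/
theorem stmt_3 (R : Type) [CommRing R] [IsNoetherianRing R]
    (M : Type) [AddCommGroup M] [Module R M] [Module.Finite R M]
    (g : ℕ) (hg : mgrade R M = g) (hM : IsTotallySelfDual R M)
    (x : R) (hreg : ∀ m : M, x • m = 0 → m = 0)
    (hne : (x • ⊤ : Submodule R M) ≠ ⊤) :
    IsTotallySelfDual R (M ⧸ (x • ⊤ : Submodule R M)) ∧
      mgrade R (M ⧸ (x • ⊤ : Submodule R M)) = g + 1 := by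
  obtain ⟨-, ⟨φ⟩, hvan⟩ := hM
  rw [hg] at φ hvan
  have hnt : Nontrivial (M ⧸ (x • ⊤ : Submodule R M)) :=
    Submodule.Quotient.nontrivial_iff.mpr hne
  have hreg' : IsSMulRegular (ModuleCat.of R M) x :=
    (isSMulRegular_iff_right_eq_zero_of_smul (M := M)).mpr hreg
  have hvanE (i : ℕ) (hi : i ≠ g) :
      Subsingleton (Abelian.Ext (ModuleCat.of R M) (ModuleCat.of R R) i) :=
    have := hvan i hi
    (extModLinearEquiv R M R i).symm.toEquiv.subsingleton
  let ψ : M ≃ₗ[R] Abelian.Ext (ModuleCat.of R M) (ModuleCat.of R R) g :=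
    φ.symm ≪≫ₗ extModLinearEquiv R M R g
  have htors (i : ℕ) (e : Abelian.Ext (ModuleCat.of R M) (ModuleCat.of R R) i)
      (he : x • e = 0) : e = 0 := by
    by_cases hi : i = g
    · subst hi
      exact ψ.symm.map_eq_zero_iff.mp (hreg _ (by rw [← map_smul, he, map_zero]))
    · exact (hvanE i hi).elim _ _
  have hvanQ (i : ℕ) (hi : i ≠ g + 1) :
      Subsingleton (ExtMod R (M ⧸ (x • ⊤ : Submodule R M)) R i) :=
    have : Subsingleton (Abelian.Ext (ModuleCat.of R (M ⧸ (x • ⊤ : Submodule R M)))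
        (ModuleCat.of R R) i) := ModuleCat.subsingleton_ext_smulShortComplex hreg' i
      (fun j hj ↦ hvanE j (by lia)) (htors i)
    (extModLinearEquiv R (M ⧸ (x • ⊤ : Submodule R M)) R i).toEquiv.subsingleton
  let χ : ExtMod R (M ⧸ (x • ⊤ : Submodule R M)) R (g + 1) ≃ₗ[R]
      M ⧸ (x • ⊤ : Submodule R M) :=
    extModLinearEquiv R (M ⧸ (x • ⊤ : Submodule R M)) R (g + 1) ≪≫ₗ
      (ModuleCat.extSmulShortComplexEquiv hreg' g (hvanE _ (by lia))).symm ≪≫ₗ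
      (Submodule.Quotient.equiv _ _ ψ (by
        rw [Submodule.map_pointwise_smul, Submodule.map_top, LinearEquiv.range])).symm
  have hgrade : mgrade R (M ⧸ (x • ⊤ : Submodule R M)) = g + 1 :=
    mgrade_eq_of_nontrivial χ.toEquiv.nontrivial hvanQ
  refine ⟨⟨hnt, ?_, ?_⟩, hgrade⟩
  · rw [hgrade]
    exact ⟨χ⟩
  · rw [hgrade]
    exact hvanQ
end

section
/- Let R be a commutative noetherian local ring with residue field k. Then k is totally self-dual if and only if R is Gorenstein. -/
open CategoryTheory IsLocalRing

/-- A noetherian local ring is Gorenstein iff `Ext^i_R(k,R)` vanishes for `i ≠ dim R`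
and is isomorphic to `k` for `i = dim R`. -/
def IsGorensteinLocal (R : Type) [CommRing R] [IsLocalRing R] : Prop :=
  ∃ n : ℕ, (n : WithBot ℕ∞) = ringKrullDim R ∧
    Nonempty (ExtMod R (ResidueField R) R n ≃ₗ[R] ResidueField R) ∧
    ∀ i : ℕ, i ≠ n → Subsingleton (ExtMod R (ResidueField R) R i)

section ExtAnnihilation

open Polynomial

variable {R : Type} [CommRing R] {M : ModuleCat.{0} R} {i : ℕ}

/-- An element annihilating `N` annihilates `Ext^i(N, M)`. -/
lemma smul_ext_eq_zero_of_smul_eq_zero {N : Type} [AddCommGroup N] [Module R N] {s : R}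
    (hs : ∀ n : N, s • n = 0) (e : Abelian.Ext (ModuleCat.of R N) M i) : s • e = 0 := by
  have h : s • 𝟙 (ModuleCat.of R N) = 0 := by
    ext n
    exact hs n
  rw [← Abelian.Ext.mk₀_id_comp e, ← Abelian.Ext.smul_comp, ← Abelian.Ext.mk₀_smul, h,
    Abelian.Ext.mk₀_zero, Abelian.Ext.zero_comp]

lemma smul_ext_eq_zero_of_linearEquiv {N N' : Type} [AddCommGroup N] [Module R N]
    [AddCommGroup N'] [Module R N'] (f : N ≃ₗ[R] N') {t : R}
    (ht : ∀ e : Abelian.Ext (ModuleCat.of R N') M i, t • e = 0)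
    (e : Abelian.Ext (ModuleCat.of R N) M i) : t • e = 0 := by
  have h : e = (Abelian.Ext.mk₀ f.toModuleIso.hom).comp
      ((Abelian.Ext.mk₀ f.toModuleIso.inv).comp e (zero_add i)) (zero_add i) := by
    rw [Abelian.Ext.mk₀_comp_mk₀_assoc, Iso.hom_inv_id, Abelian.Ext.mk₀_id_comp]
  rw [h, ← Abelian.Ext.comp_smul, ht, Abelian.Ext.comp_zero]

/-- In a short exact sequence, a product of annihilators of the outer `Ext` modules annihilates
the middle one. -/
lemma mul_smul_ext_eq_zero_of_shortExact {S : ShortComplex (ModuleCat.{0} R)} (hS : S.ShortExact)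
    {s t : R} (hs : ∀ e : Abelian.Ext S.X₁ M i, s • e = 0)
    (ht : ∀ e : Abelian.Ext S.X₃ M i, t • e = 0) (e : Abelian.Ext S.X₂ M i) :
    (t * s) • e = 0 := by
  obtain ⟨e', he'⟩ := Abelian.Ext.contravariant_sequence_exact₂ hS M (s • e)
    (by rw [Abelian.Ext.comp_smul, hs])
  rw [mul_smul, ← he', ← Abelian.Ext.comp_smul, ht, Abelian.Ext.comp_zero]

/-- If `I` kills the finite module `N` and `Q` is the only prime with `I ≤ Q' ≤ Q`, then
vanishing of `Ext^i(R/Q, M)` at `Q` implies vanishing of `Ext^i(N, M)` at `Q`. -/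
lemma exists_notMem_smul_ext_eq_zero [IsNoetherianRing R] (I Q : Ideal R) [Q.IsPrime]
    (hQ : ∀ Q' : Ideal R, Q'.IsPrime → I ≤ Q' → Q' ≤ Q → Q' = Q)
    (h : ∃ t ∉ Q, ∀ e : Abelian.Ext (ModuleCat.of R (R ⧸ Q)) M i, t • e = 0)
    {N : Type} [AddCommGroup N] [Module R N] [hN : Module.Finite R N]
    (hIN : ∀ x ∈ I, ∀ n : N, x • n = 0) :
    ∃ t ∉ Q, ∀ e : Abelian.Ext (ModuleCat.of R N) M i, t • e = 0 := by
  induction hN using IsNoetherianRing.induction_on_isQuotientEquivQuotientPrime R with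
  | subsingleton N =>
    exact ⟨1, (Ideal.ne_top_iff_one Q).mp Ideal.IsPrime.ne_top',
      smul_ext_eq_zero_of_smul_eq_zero fun n ↦ Subsingleton.elim _ _⟩
  | quotient N p f =>
    have hIp : I ≤ p.asIdeal := fun x hx ↦ by
      have h1 : x • (1 : R ⧸ p.asIdeal) = 0 := by
        rw [← f.apply_symm_apply 1, ← map_smul, hIN x hx, map_zero]
      rwa [Algebra.smul_def, mul_one, Ideal.Quotient.algebraMap_eq,
        Ideal.Quotient.eq_zero_iff_mem] at h1
    by_cases hpQ : p.asIdeal ≤ Q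
    · obtain ⟨t, htQ, ht⟩ := h
      have hpeq := hQ _ p.2 hIp hpQ
      exact ⟨t, htQ, smul_ext_eq_zero_of_linearEquiv
        (f.trans (Submodule.quotEquivOfEq _ _ hpeq)) ht⟩
    · obtain ⟨s, hsp, hsQ⟩ := SetLike.not_le_iff_exists.mp hpQ
      refine ⟨s, hsQ, smul_ext_eq_zero_of_smul_eq_zero fun n ↦ f.injective ?_⟩
      rw [map_smul, map_zero]
      obtain ⟨r, hr⟩ := Ideal.Quotient.mk_surjective (f n)
      rw [← hr, Algebra.smul_def, Ideal.Quotient.algebraMap_eq, ← map_mul,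
        Ideal.Quotient.eq_zero_iff_mem]
      exact p.asIdeal.mul_mem_right r hsp
  | exact N₁ N₂ N₃ f g hf hg hfg h₁ h₃ =>
    obtain ⟨s, hsQ, hs⟩ := h₁ fun x hx n ↦ hf (by rw [map_smul, map_zero, hIN x hx])
    obtain ⟨t, htQ, ht⟩ := h₃ fun x hx n ↦ by
      obtain ⟨n, rfl⟩ := hg n
      rw [← map_smul, hIN x hx, map_zero]
    have hS : (ShortComplex.mk (ModuleCat.ofHom f) (ModuleCat.ofHom g)
        (by ext n; exact hfg.apply_apply_eq_zero n)).ShortExact :=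
      ModuleCat.shortComplex_shortExact _ hfg hf hg
    exact ⟨t * s, fun hts ↦ (Ideal.IsPrime.mem_or_mem ‹_› hts).elim htQ hsQ,
      mul_smul_ext_eq_zero_of_shortExact hS hs ht⟩

/-- A form of Nakayama's lemma: if `tE ⊆ xE` with `x ∈ Q` and `t ∉ Q`, then `E` vanishes
at `Q`. -/
lemma exists_notMem_smul_eq_zero_of_smul_eq_smul {E : Type*} [AddCommGroup E] [Module R E]
    [Module.Finite R E] (Q : Ideal R) [Q.IsPrime] {x t : R} (hx : x ∈ Q) (ht : t ∉ Q)
    (h : ∀ e : E, ∃ e' : E, t • e = x • e') : ∃ s ∉ Q, ∀ e : E, s • e = 0 := by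
  obtain ⟨p, hp, -, hcoeff, hzero⟩ :=
    LinearMap.exists_monic_and_natDegree_eq_and_coeff_mem_pow_and_aeval_eq_zero R
      (algebraMap R (Module.End R E) t) Q (by
        rintro _ ⟨e, rfl⟩
        obtain ⟨e', he'⟩ := h e
        rw [Module.algebraMap_end_apply, he']
        exact Submodule.smul_mem_smul hx trivial)
  refine ⟨p.eval t, fun hmem ↦ ht ?_, fun e ↦ ?_⟩
  · rw [← Ideal.Quotient.eq_zero_iff_mem] at hmem ⊢
    have hmap : p.map (Ideal.Quotient.mk Q) = X ^ p.natDegree := by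
      ext k
      rw [coeff_map, coeff_X_pow]
      split_ifs with hk
      · rw [hk, hp.coeff_natDegree, map_one]
      · rw [Ideal.Quotient.eq_zero_iff_mem]
        rcases lt_or_gt_of_ne hk with hk | hk
        · exact Ideal.pow_le_self (Nat.sub_ne_zero_of_lt hk) (hcoeff k)
        · rw [coeff_eq_zero_of_natDegree_lt hk]
          exact Q.zero_mem
    rw [← eval₂_at_apply, ← Polynomial.eval_map, hmap, Polynomial.eval_pow, Polynomial.eval_X] at hmem
    exact eq_zero_of_pow_eq_zero hmem
  · rw [aeval_algebraMap_apply] at hzero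
    simpa using LinearMap.congr_fun hzero e

/-- A lemma of Bass: if there is no prime strictly between `P < Q` and `Ext^{i+1}(R/Q, M)` vanishes
at `Q`, then `Ext^i(R/P, M)` vanishes at `P`. -/
lemma exists_notMem_smul_ext_eq_zero_of_lt [IsNoetherianRing R] [Module.Finite R M]
    (P Q : Ideal R) [P.IsPrime] [Q.IsPrime] (hPQ : P < Q)
    (hQ : ∀ Q' : Ideal R, Q'.IsPrime → P < Q' → Q' ≤ Q → Q' = Q)
    (h : ∃ t ∉ Q, ∀ e : Abelian.Ext (ModuleCat.of R (R ⧸ Q)) M (i + 1), t • e = 0) :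
    ∃ s ∉ P, ∀ e : Abelian.Ext (ModuleCat.of R (R ⧸ P)) M i, s • e = 0 := by
  obtain ⟨x, hxQ, hxP⟩ := SetLike.exists_of_lt hPQ
  let f : (R ⧸ P) →ₗ[R] (R ⧸ P) := x • LinearMap.id
  have hf : Function.Injective f := by
    rw [← LinearMap.ker_eq_bot, LinearMap.ker_eq_bot']
    intro m hm
    obtain ⟨r, rfl⟩ := Ideal.Quotient.mk_surjective m
    replace hm : Ideal.Quotient.mk P (x * r) = 0 := hm
    rw [Ideal.Quotient.eq_zero_iff_mem] at hm ⊢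
    exact (Ideal.IsPrime.mem_or_mem ‹_› hm).resolve_left hxP
  have hS : (ShortComplex.mk (ModuleCat.ofHom f) (ModuleCat.ofHom (LinearMap.range f).mkQ)
      (by ext; exact (LinearMap.exact_map_mkQ_range f).apply_apply_eq_zero _)).ShortExact :=
    ModuleCat.shortComplex_shortExact _ (LinearMap.exact_map_mkQ_range f) hf
      (Submodule.mkQ_surjective _)
  obtain ⟨t, htQ, ht⟩ := exists_notMem_smul_ext_eq_zero (P ⊔ Ideal.span {x}) Q
    (fun Q' hQ' hle hQ'Q ↦ hQ Q' hQ' (lt_of_le_of_ne (le_sup_left.trans hle) fun hPQ' ↦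
      hxP (hPQ' ▸ hle (Ideal.mem_sup_right (Ideal.mem_span_singleton_self x)))) hQ'Q) h
    (N := (R ⧸ P) ⧸ LinearMap.range f) (by
      intro y hy n
      obtain ⟨m, rfl⟩ := Submodule.mkQ_surjective _ n
      obtain ⟨r, rfl⟩ := Ideal.Quotient.mk_surjective m
      obtain ⟨a, ha, b, hb, rfl⟩ := Submodule.mem_sup.mp hy
      obtain ⟨c, rfl⟩ := Ideal.mem_span_singleton'.mp hb
      rw [← map_smul, Submodule.mkQ_apply, Submodule.Quotient.mk_eq_zero]
      refine ⟨Ideal.Quotient.mk P (c * r), ?_⟩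
      change Ideal.Quotient.mk P (x * (c * r)) = Ideal.Quotient.mk P ((a + c * x) * r)
      rw [Ideal.Quotient.eq]
      convert P.neg_mem (P.mul_mem_right r ha) using 1
      ring)
  obtain ⟨s, hsQ, hs⟩ := exists_notMem_smul_eq_zero_of_smul_eq_smul Q hxQ htQ
    (E := Abelian.Ext (ModuleCat.of R (R ⧸ P)) M i) fun e ↦ by
      obtain ⟨e', he'⟩ := Abelian.Ext.contravariant_sequence_exact₁ hS M (t • e) (add_comm 1 i)
        (by rw [Abelian.Ext.comp_smul, ht])
      refine ⟨e', he'.symm.trans ?_⟩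
      have hfx : ModuleCat.ofHom f = x • 𝟙 (ModuleCat.of R (R ⧸ P)) := rfl
      change (Abelian.Ext.mk₀ (ModuleCat.ofHom f)).comp e' _ = _
      rw [hfx, Abelian.Ext.mk₀_smul, Abelian.Ext.smul_comp, Abelian.Ext.mk₀_id_comp]
  exact ⟨s, fun hsP ↦ hsQ (hPQ.le hsP), hs⟩

/-- `Ext^h(R/Q, R)` does not vanish at a prime `Q` of height `h`. -/
lemma exists_smul_ext_ne_zero_of_height_eq [IsNoetherianRing R] (h : ℕ) (Q : PrimeSpectrum R)
    (hQ : Order.height Q = h) {t : R} (ht : t ∉ Q.asIdeal) :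
    ∃ e : Abelian.Ext (ModuleCat.of R (R ⧸ Q.asIdeal)) (ModuleCat.of R R) h, t • e ≠ 0 := by
  induction h generalizing Q t with
  | zero =>
    have hmin : Q.asIdeal ∈ (Module.annihilator R R).minimalPrimes := by
      rw [Module.annihilator_eq_bot.mpr inferInstance]
      rw [Nat.cast_zero, ← PrimeSpectrum.height_eq_orderHeight, Ideal.height_eq_zero_iff] at hQ
      exact hQ
    obtain ⟨-, f, hf⟩ := (isAssociatedPrime_iff_exists_injective_linearMap _ _).mp
      (Module.associatedPrimes.minimalPrimes_annihilator_subset_associatedPrimes R R hmin)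
    refine ⟨Abelian.Ext.linearEquiv₀ (R := R).symm (ModuleCat.ofHom f), fun h ↦ ht ?_⟩
    rw [← map_smul, LinearEquiv.map_eq_zero_iff] at h
    have h1 : t • f (Ideal.Quotient.mk _ 1) = 0 :=
      LinearMap.congr_fun (congrArg ModuleCat.Hom.hom h) (Ideal.Quotient.mk _ 1)
    rw [← map_smul, map_eq_zero_iff f hf] at h1
    replace h1 : Ideal.Quotient.mk Q.asIdeal (t * 1) = 0 := h1
    rwa [mul_one, Ideal.Quotient.eq_zero_iff_mem] at h1
  | succ h ih =>
    by_contra! hzero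
    obtain ⟨-, hP, hmax⟩ := Order.height_eq_coe_add_one_iff.mp hQ
    obtain ⟨P, hPQ, hP⟩ := hP
    obtain ⟨s, hs, hs0⟩ := exists_notMem_smul_ext_eq_zero_of_lt P.asIdeal Q.asIdeal hPQ
      (fun Q' hQ' hlt hle ↦ by
        by_contra hne
        have h1 : Order.height (⟨Q', hQ'⟩ : PrimeSpectrum R) ≤ h :=
          hmax _ (lt_of_le_of_ne hle fun h ↦ hne (congrArg PrimeSpectrum.asIdeal h))
        have h2 : Order.height P + 1 ≤ Order.height (⟨Q', hQ'⟩ : PrimeSpectrum R) :=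
          Order.height_add_one_le hlt
        have h3 := h2.trans h1
        rw [hP] at h3
        norm_cast at h3
        lia) ⟨t, ht, hzero⟩
    obtain ⟨e, he⟩ := ih P hP hs
    exact he (hs0 e)

lemma subsingleton_ext_of_subsingleton_extMod {N N' : Type} [AddCommGroup N] [Module R N]
    [AddCommGroup N'] [Module R N'] (h : Subsingleton (ExtMod R N N' i)) :
    Subsingleton (Abelian.Ext (ModuleCat.of R N) (ModuleCat.of R N') i) := by
  let P := projectiveResolution (ModuleCat.of R N)
  have hex : (P.complex.linearYonedaObj R (ModuleCat.of R N')).ExactAt i := by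
    rw [HomologicalComplex.exactAt_iff_isZero_homology]
    have : Subsingleton (((_root_.Ext R (ModuleCat.{0} R) i).obj
        (Opposite.op (ModuleCat.of R N))).obj (ModuleCat.of R N')) := h
    exact (ModuleCat.isZero_of_subsingleton _).of_iso (P.isoExt i (ModuleCat.of R N')).symm
  refine subsingleton_of_forall_eq 0 fun e ↦ ?_
  obtain ⟨f, hf, rfl⟩ := P.extMk_surjective e (i + 1) rfl
  cases i with
  | zero =>
    rw [HomologicalComplex.exactAt_iff' _ 0 0 1 (by simp) (by simp),
      ShortComplex.moduleCat_exact_iff] at hex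
    obtain ⟨g, hg⟩ : ∃ g : P.complex.X 0 ⟶ ModuleCat.of R N', P.complex.d 0 0 ≫ g = f := hex f hf
    obtain rfl : f = 0 := by rw [← hg, P.complex.shape 0 0 (by simp), Limits.zero_comp]
    exact P.extMk_zero _ rfl
  | succ p =>
    rw [HomologicalComplex.exactAt_iff' _ p (p + 1) (p + 2) (by simp) (by simp),
      ShortComplex.moduleCat_exact_iff] at hex
    exact (P.extMk_eq_zero_iff f _ rfl hf p rfl).mpr (hex f hf)

end ExtAnnihilation

/-- For a noetherian local ring `R` with residue field `k`, `k` is totally self-dual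
iff `R` is Gorenstein. -/
theorem stmt_5 (R : Type) [CommRing R] [IsLocalRing R] [IsNoetherianRing R] :
    IsTotallySelfDual R (ResidueField R) ↔ IsGorensteinLocal R := by
  constructor
  · rintro ⟨-, hiso, hzero⟩
    refine ⟨mgrade R (ResidueField R), ?_, hiso, hzero⟩
    obtain ⟨d, hd⟩ := ENat.ne_top_iff_exists.mp
      (Ideal.height_ne_top (I := maximalIdeal R) Ideal.IsPrime.ne_top')
    rw [← maximalIdeal_height_eq_ringKrullDim, ← hd]
    by_cases hdg : d = mgrade R (ResidueField R)
    · rw [hdg]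
      rfl
    · have := subsingleton_ext_of_subsingleton_extMod (hzero d hdg)
      obtain ⟨e, he⟩ := exists_smul_ext_ne_zero_of_height_eq d (closedPoint R)
        ((PrimeSpectrum.height_eq_orderHeight _).symm.trans hd.symm)
        ((Ideal.ne_top_iff_one _).mp (closedPoint R).2.ne_top)
      exact absurd (@Subsingleton.elim _ this _ _) he
  · rintro ⟨n, -, ⟨φ⟩, hzero⟩
    have hset : {i | Nontrivial (ExtMod R (ResidueField R) R i)} = {n} := by
      ext i
      refine ⟨fun hi ↦ ?_, fun hi ↦ ?_⟩
      · by_contra hin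
        exact not_subsingleton_iff_nontrivial.mpr hi (hzero i hin)
      · obtain rfl : i = n := hi
        exact φ.toEquiv.nontrivial
    have hg : mgrade R (ResidueField R) = n := by rw [mgrade, hset, csInf_singleton]
    exact ⟨inferInstance, hg ▸ ⟨φ⟩, fun i hi ↦ hzero i (hg ▸ hi)⟩
end

section
/- Let R be a commutative noetherian ring, f ∈ R a regular element that is not a unit, and (φ, ψ) a matrix factorization of f (square matrices of size n with φψ = ψφ = f·E). Set M = Coker φ. Then M is a perfect R-module of grade 1 and Ext^1_R(M,R) ≅ Coker(φ^T). -/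
open CategoryTheory IsLocalRing

/-- `ProjDimLE R n M` means `M` has projective dimension at most `n`. -/
def ProjDimLE (R : Type) [CommRing R] : ℕ → ModuleCat.{0} R → Prop
  | 0, M => Module.Projective R M
  | n+1, M => ∃ (P : ModuleCat.{0} R) (f : P →ₗ[R] M), Module.Projective R P ∧
      Function.Surjective f ∧ ProjDimLE R n (ModuleCat.of R (LinearMap.ker f))

namespace ModuleCat

open Limits

universe u

variable {R : Type u} [CommRing R] {A B : Type u} [AddCommGroup A] [Module R A]
  [AddCommGroup B] [Module R B] (g : A →ₗ[R] B)

/-- The objects `B, A, 0, 0, …` of the chain complex given by a linear map `A → B`. -/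
def twoTermX (R A B : Type u) [CommRing R] [AddCommGroup A] [Module R A]
    [AddCommGroup B] [Module R B] : ℕ → ModuleCat.{u} R
  | 0 => of R B
  | 1 => of R A
  | _ + 2 => of R PUnit

/-- The differentials of the chain complex given by a linear map `A → B`. -/
def twoTermD : ∀ i : ℕ, twoTermX R A B (i + 1) ⟶ twoTermX R A B i
  | 0 => ofHom g
  | _ + 1 => 0

/-- The chain complex `⋯ → 0 → A → B` given by a linear map `A → B`. -/
noncomputable def twoTermComplex : ChainComplex (ModuleCat.{u} R) ℕ :=
  ChainComplex.of (twoTermX R A B) (twoTermD g) fun _ => zero_comp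

lemma twoTermComplex_d_one_zero : (twoTermComplex g).d 1 0 = ofHom g :=
  ChainComplex.of_d (twoTermX R A B) (twoTermD g) 0

lemma twoTermComplex_d_succ (i : ℕ) : (twoTermComplex g).d (i + 2) (i + 1) = 0 :=
  ChainComplex.of_d (twoTermX R A B) (twoTermD g) (i + 1)

lemma ofHom_comp_mkQ_range : ofHom g ≫ ofHom (LinearMap.range g).mkQ = 0 := by
  ext x
  exact (Submodule.Quotient.mk_eq_zero _).2 ⟨x, rfl⟩

lemma twoTermComplex_d_comp_mkQ_range :
    (twoTermComplex g).d 1 0 ≫ ofHom (LinearMap.range g).mkQ = 0 := by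
  rw [twoTermComplex_d_one_zero]
  exact ofHom_comp_mkQ_range g

variable {g}

lemma twoTermComplex_exactAt_succ (hg : Function.Injective g) (i : ℕ) :
    (twoTermComplex g).ExactAt (i + 1) := by
  rw [HomologicalComplex.exactAt_iff' _ (i + 2) (i + 1) i (by simp) (by simp),
    ShortComplex.moduleCat_exact_iff]
  intro x hx
  refine ⟨0, ?_⟩
  cases i with
  | zero =>
    replace hx : (twoTermComplex g).d 1 0 x = 0 := hx
    rw [twoTermComplex_d_one_zero] at hx
    rw [map_zero]
    exact (hg (hx.trans (map_zero g).symm)).symm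
  | succ i => exact Subsingleton.elim (α := PUnit) _ _

/-- The projective resolution `0 → A → B` of the cokernel of an injective linear map `A → B`
between projective modules. -/
noncomputable def twoTermResolution [Module.Projective R A] [Module.Projective R B]
    (hg : Function.Injective g) :
    ProjectiveResolution (of R (B ⧸ LinearMap.range g)) where
  complex := twoTermComplex g
  projective
    | 0 => (IsProjective.iff_projective B).1 inferInstance
    | 1 => (IsProjective.iff_projective A).1 inferInstance
    | _ + 2 => (IsProjective.iff_projective (R := R) PUnit).1 inferInstance
  π := (ChainComplex.toSingle₀Equiv _ _).symm ⟨ofHom (LinearMap.range g).mkQ,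
    twoTermComplex_d_comp_mkQ_range g⟩
  quasiIso := ⟨fun n => by
    cases n with
    | zero =>
      rw [ChainComplex.quasiIsoAt₀_iff, ShortComplex.quasiIso_iff_of_zeros' _ rfl rfl rfl]
      refine (ShortComplex.exact_and_epi_g_iff_of_iso (S₂ := ShortComplex.mk (ofHom g)
        (ofHom (LinearMap.range g).mkQ) (ofHom_comp_mkQ_range g)) ?_).2 ⟨?_, ?_⟩
      · exact ShortComplex.isoMk (Iso.refl _) (Iso.refl _) (Iso.refl _)
          (by
            refine (Category.id_comp _).trans (Eq.trans ?_ (Category.comp_id _).symm)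
            exact (twoTermComplex_d_one_zero g).symm)
          (by
            refine (Category.id_comp _).trans (Eq.trans ?_ (Category.comp_id _).symm)
            exact (ChainComplex.toSingle₀Equiv_symm_apply_f_zero _
              (twoTermComplex_d_comp_mkQ_range g)))
      · rw [ShortComplex.moduleCat_exact_iff]
        intro x hx
        exact (Submodule.Quotient.mk_eq_zero _).1 hx
      · exact (epi_iff_surjective _).2 (Submodule.mkQ_surjective _)
    | succ n =>
      rw [quasiIsoAt_iff_exactAt' _ _ (ChainComplex.exactAt_succ_single_obj _ _)]
      exact twoTermComplex_exactAt_succ hg n⟩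

/-- `Ext⁰(B / g(A), N)` vanishes if every linear map `B → N` that vanishes on `g(A)` is zero. -/
lemma subsingleton_ext_zero [Module.Projective R A] [Module.Projective R B]
    (hg : Function.Injective g) (N : ModuleCat.{u} R)
    (h : ∀ α : B →ₗ[R] N, α ∘ₗ g = 0 → α = 0) :
    Subsingleton (((Ext R (ModuleCat.{u} R) 0).obj
      (Opposite.op (of R (B ⧸ LinearMap.range g)))).obj N) := by
  refine (isZero_iff_subsingleton).1 (IsZero.of_iso ?_ ((twoTermResolution hg).isoExt 0 N))
  rw [← HomologicalComplex.exactAt_iff_isZero_homology,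
    HomologicalComplex.exactAt_iff' _ 0 0 1 (by simp) (by simp), ShortComplex.moduleCat_exact_iff]
  intro (x : of R B ⟶ N) hx
  replace hx : (twoTermComplex g).d 1 0 ≫ x = 0 := hx
  rw [twoTermComplex_d_one_zero] at hx
  refine ⟨0, ?_⟩
  rw [map_zero]
  exact (hom_ext (h x.hom congr(($hx).hom))).symm

/-- `Ext¹(B / g(A), N)` is the cokernel of `Hom(B, N) → Hom(A, N)`. -/
lemma nonempty_ext_one_equiv [Module.Projective R A] [Module.Projective R B]
    (hg : Function.Injective g) (N : ModuleCat.{u} R) :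
    Nonempty (((Ext R (ModuleCat.{u} R) 1).obj
      (Opposite.op (of R (B ⧸ LinearMap.range g)))).obj N ≃ₗ[R]
      (A →ₗ[R] N) ⧸ LinearMap.range (LinearMap.lcomp R N g)) := by
  let K := (twoTermComplex g).linearYonedaObj R N
  let S := K.sc' 0 1 2
  have hS : S.g = 0 := by
    ext (x : (twoTermComplex g).X 1 ⟶ N)
    have : (twoTermComplex g).d 2 1 ≫ x = 0 := by rw [twoTermComplex_d_succ, zero_comp]
    exact this
  have e1 : ((Ext R (ModuleCat.{u} R) 1).obj
      (Opposite.op (of R (B ⧸ LinearMap.range g)))).obj N ≅ S.homology :=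
    (twoTermResolution hg).isoExt 1 N ≪≫
      ShortComplex.homologyMapIso (K.isoSc' 0 1 2 (by simp) (by simp))
  have e2 := (S.asIsoHomologyι hS ≪≫ S.moduleCatOpcyclesIso).toLinearEquiv
  let e3 : S.X₂ ≃ₗ[R] (A →ₗ[R] N) := homLinearEquiv (M := of R A)
  refine ⟨e1.toLinearEquiv ≪≫ₗ e2 ≪≫ₗ Submodule.Quotient.equiv _ _ e3 ?_⟩
  have hf (x : B →ₗ[R] N) : e3 (S.f.hom (ofHom x : of R B ⟶ N)) = LinearMap.lcomp R N g x := by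
    change ((twoTermComplex g).d 1 0 ≫ (ofHom x : of R B ⟶ N)).hom = _
    rw [twoTermComplex_d_one_zero]
    rfl
  ext y
  constructor
  · rintro ⟨_, ⟨x, rfl⟩, rfl⟩
    exact ⟨_, (hf (homLinearEquiv (S := R) (M := of R B) (N := N) x)).symm⟩
  · rintro ⟨x, rfl⟩
    exact ⟨_, ⟨_, rfl⟩, hf x⟩

end ModuleCat

namespace Matrix

variable {R n : Type*} [CommRing R] [Fintype n] {f : R} {φ ψ : Matrix n n R}

lemma mulVec_mulVec_of_mul_eq_smul_one [DecidableEq n] (h : φ * ψ = f • (1 : Matrix n n R))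
    (v : n → R) : φ *ᵥ (ψ *ᵥ v) = f • v := by
  rw [mulVec_mulVec, h, smul_mulVec, one_mulVec]

lemma mulVecLin_injective_of_mul_eq_smul_one [DecidableEq n] (hf : f ∈ nonZeroDivisors R)
    (h : ψ * φ = f • (1 : Matrix n n R)) : Function.Injective φ.mulVecLin := by
  rw [injective_iff_map_eq_zero]
  intro v hv
  have h0 := mulVec_mulVec_of_mul_eq_smul_one h v
  rw [show φ *ᵥ v = 0 from hv, mulVec_zero] at h0
  ext i
  exact (mem_nonZeroDivisors_iff.1 hf).1 _ (congrFun h0 i).symm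

/-- The scalar `f` annihilates the cokernel of `φ` as soon as `φ * ψ = f • 1`. -/
lemma smul_quotient_range_mulVecLin_eq_zero [DecidableEq n] (h : φ * ψ = f • (1 : Matrix n n R))
    (x : (n → R) ⧸ LinearMap.range φ.mulVecLin) : f • x = 0 := by
  obtain ⟨v, rfl⟩ := Submodule.Quotient.mk_surjective _ x
  rw [← Submodule.Quotient.mk_smul, Submodule.Quotient.mk_eq_zero]
  exact ⟨ψ *ᵥ v, mulVec_mulVec_of_mul_eq_smul_one h v⟩

lemma mulVecLin_surjective_of_transpose [DecidableEq n]
    (h : Function.Surjective φ.transpose.mulVecLin) : Function.Surjective φ.mulVecLin := by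
  have hu : IsUnit φ.transpose := mulVec_surjective_iff_isUnit.1 h
  exact mulVec_surjective_iff_isUnit.2 ((isUnit_transpose φ).1 hu)

/-- The cokernel of the dual of `φ` is the cokernel of the transpose of `φ`. -/
lemma nonempty_quotient_range_lcomp_mulVecLin_equiv [DecidableEq n] (φ : Matrix n n R) :
    Nonempty ((((n → R) →ₗ[R] R) ⧸ LinearMap.range (LinearMap.lcomp R R φ.mulVecLin)) ≃ₗ[R]
      ((n → R) ⧸ LinearMap.range φ.transpose.mulVecLin)) := by
  let e : (n → R) ≃ₗ[R] ((n → R) →ₗ[R] R) := dotProductEquiv R n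
  have he (v : n → R) : LinearMap.lcomp R R φ.mulVecLin (e v) = e (φ.transpose *ᵥ v) := by
    refine LinearMap.ext fun w => ?_
    change v ⬝ᵥ φ *ᵥ w = (φ.transpose *ᵥ v) ⬝ᵥ w
    rw [dotProduct_mulVec, mulVec_transpose]
  refine ⟨(Submodule.Quotient.equiv _ _ e ?_).symm⟩
  ext y
  constructor
  · rintro ⟨_, ⟨v, rfl⟩, rfl⟩
    exact ⟨e v, he v⟩
  · rintro ⟨x, rfl⟩
    obtain ⟨v, rfl⟩ := e.surjective x
    exact ⟨_, ⟨v, rfl⟩, (he v).symm⟩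

end Matrix

/-- A projective module annihilated by a nonzerodivisor is zero. -/
lemma Module.Projective.subsingleton_of_smul_eq_zero {R M : Type*} [CommRing R] [AddCommGroup M]
    [Module R M] [Module.Projective R M] {f : R} (hf : f ∈ nonZeroDivisors R)
    (h : ∀ x : M, f • x = 0) : Subsingleton M := by
  obtain ⟨s, hs⟩ := Module.projective_def'.1 ‹Module.Projective R M›
  refine subsingleton_of_forall_eq 0 fun x => ?_
  have hx : s x = 0 := by
    refine Finsupp.ext fun i => ?_
    have := congr($(congrArg s (h x)) i)
    rw [map_smul, map_zero] at this
    exact (mem_nonZeroDivisors_iff.1 hf).1 _ this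
  simpa [hx] using congr($hs x).symm

/-- For a matrix factorization `(φ, ψ)` of a regular non-unit `f`, the cokernel `M` of `φ`
is a perfect module of grade 1 with `Ext¹_R(M,R) ≅ Coker φᵀ`. -/
theorem stmt_7 (R : Type) [CommRing R] [IsNoetherianRing R] (f : R)
    (hreg : f ∈ nonZeroDivisors R) (hunit : ¬ IsUnit f)
    (n : ℕ) (φ ψ : Matrix (Fin n) (Fin n) R)
    (h1 : φ * ψ = f • (1 : Matrix (Fin n) (Fin n) R))
    (h2 : ψ * φ = f • (1 : Matrix (Fin n) (Fin n) R))
    (hM : Nontrivial ((Fin n → R) ⧸ LinearMap.range φ.mulVecLin)) :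
    mgrade R ((Fin n → R) ⧸ LinearMap.range φ.mulVecLin) = 1 ∧
    ProjDimLE R 1 (ModuleCat.of R ((Fin n → R) ⧸ LinearMap.range φ.mulVecLin)) ∧
    ¬ ProjDimLE R 0 (ModuleCat.of R ((Fin n → R) ⧸ LinearMap.range φ.mulVecLin)) ∧
    Nonempty (ExtMod R ((Fin n → R) ⧸ LinearMap.range φ.mulVecLin) R 1 ≃ₗ[R]
      ((Fin n → R) ⧸ LinearMap.range φ.transpose.mulVecLin)) := by
  have hinj := Matrix.mulVecLin_injective_of_mul_eq_smul_one hreg h2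
  obtain ⟨e⟩ := ModuleCat.nonempty_ext_one_equiv hinj (ModuleCat.of R R)
  obtain ⟨e'⟩ := Matrix.nonempty_quotient_range_lcomp_mulVecLin_equiv φ
  have hExt1 : Nontrivial (ExtMod R ((Fin n → R) ⧸ LinearMap.range φ.mulVecLin) R 1) := by
    refine (e ≪≫ₗ e').toEquiv.nontrivial_congr.2 ?_
    rw [Submodule.Quotient.nontrivial_iff] at hM ⊢
    exact fun h => hM (LinearMap.range_eq_top.2
      (Matrix.mulVecLin_surjective_of_transpose (LinearMap.range_eq_top.1 h)))
  have hExt0 : Subsingleton (ExtMod R ((Fin n → R) ⧸ LinearMap.range φ.mulVecLin) R 0) := by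
    refine ModuleCat.subsingleton_ext_zero hinj (ModuleCat.of R R) fun α hα => ?_
    refine LinearMap.ext fun v => (mem_nonZeroDivisors_iff.1 hreg).1 _ ?_
    rw [← smul_eq_mul]
    refine (map_smul α f v).symm.trans ?_
    rw [← Matrix.mulVec_mulVec_of_mul_eq_smul_one h1 v]
    exact congr($hα (ψ.mulVec v))
  refine ⟨le_antisymm (Nat.sInf_le hExt1) ?_, ?_, ?_, ⟨e ≪≫ₗ e'⟩⟩
  · refine le_csInf ⟨1, hExt1⟩ fun i hi => Nat.one_le_iff_ne_zero.2 ?_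
    rintro rfl
    exact not_nontrivial_iff_subsingleton.2 hExt0 hi
  · refine ⟨ModuleCat.of R (Fin n → R), (LinearMap.range φ.mulVecLin).mkQ,
      inferInstanceAs (Module.Projective R (Fin n → R)), Submodule.mkQ_surjective _, ?_⟩
    change Module.Projective R (LinearMap.ker (LinearMap.range φ.mulVecLin).mkQ)
    rw [Submodule.ker_mkQ]
    exact .of_equiv (LinearEquiv.ofInjective _ hinj)
  · intro (h : Module.Projective R ((Fin n → R) ⧸ LinearMap.range φ.mulVecLin))
    exact not_subsingleton _ (Module.Projective.subsingleton_of_smul_eq_zero hreg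
      (Matrix.smul_quotient_range_mulVecLin_eq_zero h1))
end
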